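/- (L¹–L∞ smoothing for Ricci flows with weak initial data.) There exists a universal constant C₀ > 0 with the following property. Let r > 0, T > 0, let B_ρ denote the open Euclidean ball in ℂ of radius ρ centred at the origin, and let u : B_{3r} × (0,T) → (0,∞) be a smooth positive function solving the logarithmic fast diffusion equation ∂u/∂t = Δ log u. Suppose μ is a non-zero Radon measure on B_{3r} with no atoms such that u starts weakly from μ, i.e. for every continuous function f : ℂ → ℝ with compact support contained in B_{3r}, ∫ f(z) u(z,t) dλ(z) → ∫ f dμ as t ↘ 0, where λ is Lebesgue measure on ℂ. Then for every t ∈ (0,T) with t > μ(closure(B_{2r}))/(2π), one has sup_{B_r} u(·,t) ≤ C₀ r⁻² t. -/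

import Mathlib

open Set MeasureTheory Filter Metric

/-- The Euclidean Laplacian of `f : ℂ → ℝ` at `z`, i.e. `∂²f/∂x² + ∂²f/∂y²`. -/
noncomputable def lap (f : ℂ → ℝ) (z : ℂ) : ℝ :=
  iteratedFDeriv ℝ 2 f z ![1, 1] + iteratedFDeriv ℝ 2 f z ![Complex.I, Complex.I]

/-- The time-timeSlice of a spacetime `M ⊆ ℂ × ℝ` at time `t`. -/
def timeSlice (M : Set (ℂ × ℝ)) (t : ℝ) : Set ℂ := {z | (z, t) ∈ M}

/-- The conformal distance on `Ω` induced by a conformal factor `v`: the infimum of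
`v`-lengths of `C¹` paths in `Ω` joining `x` to `y`. -/
noncomputable def confDist (v : ℂ → ℝ) (Ω : Set ℂ) (x y : ℂ) : ℝ :=
  sInf {L : ℝ | ∃ γ : ℝ → ℂ, ContDiffOn ℝ 1 γ (Icc 0 1) ∧
    (∀ s ∈ Icc (0:ℝ) 1, γ s ∈ Ω) ∧ γ 0 = x ∧ γ 1 = y ∧
    L = ∫ s in (0:ℝ)..1, Real.sqrt (v (γ s)) * ‖derivWithin γ (Icc 0 1) s‖}

/-- The conformal ball of centre `p` and radius `ρ` in `Ω` for the metric `v|dz|²`. -/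
def confBall (v : ℂ → ℝ) (Ω : Set ℂ) (p : ℂ) (ρ : ℝ) : Set ℂ :=
  {z ∈ connectedComponentIn Ω p | confDist v Ω p z < ρ}

/-- The conformal metric `v|dz|²` is complete on `Ω`: every connected component of `Ω` is a
complete metric space with respect to the induced distance `confDist v Ω`. -/
def ConfComplete (v : ℂ → ℝ) (Ω : Set ℂ) : Prop :=
  ∀ x₀ ∈ Ω, ∀ x : ℕ → ℂ, (∀ n, x n ∈ connectedComponentIn Ω x₀) →
    (∀ ε : ℝ, 0 < ε → ∃ N : ℕ, ∀ m ≥ N, ∀ n ≥ N, confDist v Ω (x m) (x n) < ε) →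
    ∃ l ∈ connectedComponentIn Ω x₀,
      Tendsto (fun n => confDist v Ω (x n) l) atTop (nhds 0)

/-- A conformal Ricci flow spacetime in the ambient space `ℂ × (0,T)`:
`M` is a connected open subset of `ℂ × (0,T)` with non-empty time-slices, and `u` is a smooth
positive conformal factor on `M` solving the logarithmic fast diffusion equation
`∂u/∂t = Δ log u`. -/
structure ConfRFS (T : ℝ) (M : Set (ℂ × ℝ)) (u : ℂ → ℝ → ℝ) : Prop where
  sub : M ⊆ {p : ℂ × ℝ | p.2 ∈ Ioo 0 T}
  opn : IsOpen M
  conn : IsConnected M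
  nonempty : ∀ t ∈ Ioo (0:ℝ) T, (timeSlice M t).Nonempty
  pos : ∀ p ∈ M, 0 < u p.1 p.2
  smooth : ContDiffOn ℝ (⊤ : ℕ∞) (fun p : ℂ × ℝ => u p.1 p.2) M
  lfde : ∀ p ∈ M, deriv (u p.1) p.2 = lap (fun z => Real.log (u z p.2)) p.1

/-- A conformal Ricci flow spacetime is complete if the metric `u(·,t)|dz|²` is complete on the
timeSlice `M_t` for every `t ∈ (0,T)`. -/
def ConfRFSComplete (T : ℝ) (M : Set (ℂ × ℝ)) (u : ℂ → ℝ → ℝ) : Prop :=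
  ∀ t ∈ Ioo (0:ℝ) T, ConfComplete (fun z => u z t) (timeSlice M t)

/-- There is a time-preserving path in `M` from time `s` to the point `(z,t)`. -/
def TimePreservingFrom (M : Set (ℂ × ℝ)) (s : ℝ) (z : ℂ) (t : ℝ) : Prop :=
  ∃ γ : ℝ → ℂ, ContinuousOn γ (Icc s t) ∧ (∀ r ∈ Icc s t, (γ r, r) ∈ M) ∧ γ t = z

/-- The hindsight function of a spacetime `M`. -/
noncomputable def hindsight (M : Set (ℂ × ℝ)) (z : ℂ) (t : ℝ) : ℝ :=
  sInf {s : ℝ | 0 < s ∧ s ≤ t ∧ TimePreservingFrom M s z t}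

/-- A spacetime is initially determined if its hindsight function vanishes identically. -/
def InitiallyDetermined (M : Set (ℂ × ℝ)) : Prop :=
  ∀ p ∈ M, hindsight M p.1 p.2 = 0

/-- A spacetime in `ℂ × (0,T)` is expanding if worldlines persist until the final time. -/
def Expanding (T : ℝ) (M : Set (ℂ × ℝ)) : Prop :=
  ∀ (z : ℂ) (t t' : ℝ), (z, t) ∈ M → t ≤ t' → t' < T → (z, t') ∈ M

/-- An expanding spacetime is continuous if each timeSlice is the interior of the intersection of
all later slices. -/
def ContinuousSpacetime (T : ℝ) (M : Set (ℂ × ℝ)) : Prop :=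
  ∀ s ∈ Ioo (0:ℝ) T, timeSlice M s = interior (⋂ t ∈ Ioo s T, timeSlice M t)

/-- The vanishing time of the point `(z,t)`: the supremum of the connected component containing
`t` of the set of times at which `z` belongs to the spacetime. -/
noncomputable def vanishTime (M : Set (ℂ × ℝ)) (z : ℂ) (t : ℝ) : ℝ :=
  sSup (connectedComponentIn {r : ℝ | (z, r) ∈ M} t)

/-- The five-point second difference of `F` at `z` with step `s`. -/
def fivePoint (F : ℂ → ℝ) (z : ℂ) (s : ℝ) : ℝ :=
  (F (z + s * 1) + F (z - s * 1) - 2 * F z) +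
    (F (z + s * Complex.I) + F (z - s * Complex.I) - 2 * F z)

theorem tendsto_symm_second_difference {φ φ' : ℝ → ℝ} {c : ℝ}
    (h : ∀ᶠ s in nhds (0 : ℝ), HasDerivAt φ (φ' s) s) (h' : HasDerivAt φ' c 0) :
    Tendsto (fun s => (φ s + φ (-s) - 2 * φ 0) / s ^ 2) (nhdsWithin 0 (Ioi 0)) (nhds c) := by
  have hneg : Tendsto (fun s : ℝ => -s) (nhds 0) (nhds 0) := by
    simpa using (continuous_neg (G := ℝ)).tendsto 0
  have hd : ∀ᶠ s in nhds (0 : ℝ),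
      HasDerivAt (fun s => φ s + φ (-s) - 2 * φ 0) (φ' s - φ' (-s)) s := by
    filter_upwards [h, hneg.eventually h] with s hs hs'
    have := (hs.add (hs'.comp s (hasDerivAt_neg s))).sub_const (2 * φ 0)
    exact this.congr_deriv (by ring)
  refine HasDerivAt.lhopital_zero_nhdsGT (f' := fun s => φ' s - φ' (-s))
    (g' := fun s => 2 * s) (hd.filter_mono nhdsWithin_le_nhds) ?_ ?_ ?_ ?_ ?_
  · exact Eventually.of_forall fun s => by simpa using hasDerivAt_pow 2 s
  · filter_upwards [self_mem_nhdsWithin] with s hs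
    have : 0 < s := hs
    positivity
  · have := hd.self_of_nhds.continuousAt.tendsto
    refine (this.mono_left nhdsWithin_le_nhds).trans (le_of_eq ?_)
    simp only [neg_zero]; congr 1; ring
  · have : Tendsto (fun s : ℝ => s ^ 2) (nhds 0) (nhds (0 ^ 2)) := (continuous_pow 2).tendsto 0
    exact (this.mono_left nhdsWithin_le_nhds).trans (le_of_eq (by simp))
  · have h1 := h'.tendsto_slope_zero_right
    have h2 := (hasDerivAt_iff_tendsto_slope_zero.1 h')
    have hneg' : Tendsto (fun s : ℝ => -s) (nhdsWithin 0 (Ioi 0)) (nhdsWithin 0 {0}ᶜ) := by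
      refine tendsto_nhdsWithin_iff.2 ⟨hneg.mono_left nhdsWithin_le_nhds, ?_⟩
      filter_upwards [self_mem_nhdsWithin] with s hs
      have : 0 < s := hs
      simpa using this.ne'
    have h3 := ((h1.add (h2.comp hneg')).const_mul (1 / 2 : ℝ))
    have : (1 / 2 : ℝ) * (c + c) = c := by ring
    rw [this] at h3
    refine h3.congr' ?_
    filter_upwards [self_mem_nhdsWithin] with s hs
    have : s ≠ 0 := (show (0:ℝ) < s from hs).ne'
    simp only [smul_eq_mul, Function.comp, zero_add]
    field_simp
    ring

theorem tendsto_directional_second_difference {F : ℂ → ℝ} {z : ℂ} (hF : ContDiffAt ℝ 2 F z)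
    (e : ℂ) :
    Tendsto (fun s : ℝ => (F (z + s * e) + F (z - s * e) - 2 * F z) / s ^ 2)
      (nhdsWithin 0 (Ioi 0)) (nhds (iteratedFDeriv ℝ 2 F z ![e, e])) := by
  have hline : ∀ s : ℝ, HasDerivAt (fun s : ℝ => z + s * e) e s := fun s => by
    simpa using ((Complex.ofRealCLM.hasDerivAt (x := s)).mul_const e).const_add z
  have hev : ∀ᶠ w in nhds z, DifferentiableAt ℝ F w :=
    (hF.eventually (by simp)).mono fun w hw => hw.differentiableAt (by simp)
  have hlim : Tendsto (fun s : ℝ => z + s * e) (nhds 0) (nhds z) := by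
    simpa using (hline 0).continuousAt.tendsto
  have h1 : ∀ᶠ s : ℝ in nhds (0 : ℝ),
      HasDerivAt (fun s : ℝ => F (z + s * e)) (fderiv ℝ F (z + s * e) e) s := by
    filter_upwards [hlim.eventually hev] with s hs
    exact hs.hasFDerivAt.comp_hasDerivAt s (hline s)
  have h2 : HasDerivAt (fun s : ℝ => fderiv ℝ F (z + s * e) e)
      (iteratedFDeriv ℝ 2 F z ![e, e]) 0 := by
    have hd : HasFDerivAt (fderiv ℝ F) (fderiv ℝ (fderiv ℝ F) z) z :=
      ((hF.fderiv_right (m := 1) (by norm_num)).differentiableAt (by simp)).hasFDerivAt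
    have hz : z + (0 : ℝ) * e = z := by simp
    have h3 : HasDerivAt (fun s : ℝ => fderiv ℝ F (z + s * e)) (fderiv ℝ (fderiv ℝ F) z e) 0 :=
      HasFDerivAt.comp_hasDerivAt_of_eq (0 : ℝ) hd (hline 0) hz.symm
    exact ((ContinuousLinearMap.apply ℝ ℝ e).hasFDerivAt.comp_hasDerivAt (0 : ℝ) h3).congr_deriv
      (by simp [iteratedFDeriv_two_apply])
  have := tendsto_symm_second_difference h1 h2
  simpa [sub_eq_add_neg] using this

theorem tendsto_fivePoint {F : ℂ → ℝ} {z : ℂ} (hF : ContDiffAt ℝ 2 F z) :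
    Tendsto (fun s : ℝ => fivePoint F z s / s ^ 2) (nhdsWithin 0 (Ioi 0)) (nhds (lap F z)) := by
  have := (tendsto_directional_second_difference hF 1).add
    (tendsto_directional_second_difference hF Complex.I)
  refine this.congr fun s => ?_
  rw [fivePoint, add_div]

/-- Discrete subsolution property of the envelope `k * max_{k ≤ j ≤ N} x j / j`. -/
theorem envelope_le_sum_increments {x : ℕ → ℝ} {N : ℕ} {σ : ℕ → ℕ} (hx : 0 ≤ x 0)
    (hσ : ∀ k, 1 ≤ k → k ≤ N → k ≤ σ k ∧ σ k ≤ N)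
    (hmax : ∀ k, 1 ≤ k → k ≤ N → ∀ j, k ≤ j → j ≤ N → x j / j ≤ x (σ k) / σ k)
    (n : ℕ) (hn : 1 ≤ n) (hnN : n ≤ N) :
    n * (x (σ n) / σ n) - x 0 ≤ ∑ k ∈ Finset.Icc 1 n, (x (σ k) - x (σ k - 1)) := by
  -- the increment bound when the maximum is attained strictly later
  have later : ∀ k, 1 ≤ k → k ≤ N → k < σ k → x (σ k) / σ k ≤ x (σ k) - x (σ k - 1) := by
    intro k hk hkN hlt
    obtain ⟨m, hm⟩ : ∃ m, σ k = m + 1 := ⟨σ k - 1, by omega⟩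
    have hmax' := hmax k hk hkN m (by omega) (by have := (hσ k hk hkN).2; omega)
    rw [hm] at hmax' ⊢
    have hm0 : (0 : ℝ) < m := by exact_mod_cast (by omega : 0 < m)
    rw [div_le_div_iff₀ hm0 (by positivity)] at hmax'
    simp only [Nat.add_sub_cancel]
    push_cast at hmax' ⊢
    rw [div_le_iff₀ (by positivity)]
    nlinarith
  induction n, hn using Nat.le_induction with
  | base =>
    simp only [Finset.Icc_self, Finset.sum_singleton, Nat.cast_one, one_mul]
    rcases (hσ 1 le_rfl hnN).1.eq_or_lt with h | h
    · simp [← h]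
    · have := later 1 le_rfl hnN h
      linarith
  | succ n hn ih =>
    rw [Finset.sum_Icc_succ_top (by omega)]
    have ih := ih (by omega)
    suffices (↑(n + 1) : ℝ) * (x (σ (n + 1)) / σ (n + 1)) - n * (x (σ n) / σ n) ≤
        x (σ (n + 1)) - x (σ (n + 1) - 1) by linarith
    have hn0 : (0 : ℝ) < n := by exact_mod_cast hn
    rcases (hσ (n + 1) (by omega) hnN).1.eq_or_lt with h | h
    · have h1 := hmax n hn (by omega) n le_rfl (by omega)
      rw [← h, Nat.add_sub_cancel, mul_div_cancel₀ _ (by positivity)]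
      have := mul_le_mul_of_nonneg_left h1 hn0.le
      rw [mul_div_cancel₀ _ hn0.ne'] at this
      linarith
    · have h1 := hmax n hn (by omega) (σ (n + 1)) (by omega) (hσ (n + 1) (by omega) hnN).2
      have h2 := later (n + 1) (by omega) hnN h
      have := mul_le_mul_of_nonneg_left h1 hn0.le
      push_cast
      linarith

/-- The conformal factor of the hyperbolic metric of curvature `-1/2` on the disc of radius `R`. -/
noncomputable def hyp (R : ℝ) (z : ℂ) : ℝ := 8 * R ^ 2 / (R ^ 2 - ‖z‖ ^ 2) ^ 2

theorem sq_sub_norm_sq_pos {R : ℝ} {z : ℂ} (hz : z ∈ ball (0 : ℂ) R) : 0 < R ^ 2 - ‖z‖ ^ 2 := by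
  have h : ‖z‖ < R := by simpa using hz
  nlinarith [norm_nonneg z]

theorem hyp_lower {R : ℝ} {z : ℂ} (hz : z ∈ ball (0 : ℂ) R) : 8 / R ^ 2 ≤ hyp R z := by
  have h := sq_sub_norm_sq_pos hz
  have hR : 0 < R ^ 2 := by nlinarith [norm_nonneg z]
  rw [hyp, div_le_div_iff₀ hR (by positivity)]
  nlinarith [norm_nonneg z, sq_nonneg ‖z‖]

theorem hyp_pos {R : ℝ} {z : ℂ} (hz : z ∈ ball (0 : ℂ) R) : 0 < hyp R z := by
  have h := sq_sub_norm_sq_pos hz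
  have hR : 0 < R ^ 2 := by nlinarith [norm_nonneg z]
  rw [hyp]; positivity

theorem continuousOn_hyp (R : ℝ) : ContinuousOn (hyp R) (ball (0 : ℂ) R) := by
  unfold hyp
  refine ContinuousOn.div (by fun_prop) (by fun_prop) fun z hz => ?_
  exact (pow_pos (sq_sub_norm_sq_pos hz) 2).ne'

theorem tendsto_second_difference_log_disc {R : ℝ} {z : ℂ} (hz : z ∈ ball (0 : ℂ) R) (e : ℂ)
    (p : ℝ) (hp : ∀ s : ℝ, ‖z + s * e‖ ^ 2 = ‖z‖ ^ 2 + 2 * p * s + s ^ 2) :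
    Tendsto (fun s : ℝ => (Real.log (R ^ 2 - ‖z + s * e‖ ^ 2) +
      Real.log (R ^ 2 - ‖z - s * e‖ ^ 2) - 2 * Real.log (R ^ 2 - ‖z‖ ^ 2)) / s ^ 2)
      (nhdsWithin 0 (Ioi 0))
      (nhds ((-2 * (R ^ 2 - ‖z‖ ^ 2) - 4 * p ^ 2) / (R ^ 2 - ‖z‖ ^ 2) ^ 2)) := by
  have hq := sq_sub_norm_sq_pos hz
  set q := R ^ 2 - ‖z‖ ^ 2 with hqdef
  have hpoly : ∀ s : ℝ, HasDerivAt (fun s : ℝ => q - 2 * p * s - s ^ 2) (-2 * p - 2 * s) s := by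
    intro s
    have := (((hasDerivAt_id s).const_mul (2 * p)).const_sub q).sub (hasDerivAt_pow 2 s)
    exact this.congr_deriv (by simp)
  have hev : ∀ᶠ s : ℝ in nhds 0, 0 < q - 2 * p * s - s ^ 2 :=
    (hpoly 0).continuousAt.eventually (lt_mem_nhds (by simpa using hq))
  have h1 : ∀ᶠ s : ℝ in nhds 0, HasDerivAt (fun s : ℝ => Real.log (q - 2 * p * s - s ^ 2))
      ((-2 * p - 2 * s) / (q - 2 * p * s - s ^ 2)) s := by
    filter_upwards [hev] with s hs using (hpoly s).log hs.ne'
  have h2 : HasDerivAt (fun s : ℝ => (-2 * p - 2 * s) / (q - 2 * p * s - s ^ 2))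
      ((-2 * q - 4 * p ^ 2) / q ^ 2) 0 := by
    have hn : HasDerivAt (fun s : ℝ => -2 * p - 2 * s) (-2) 0 := by
      simpa using ((hasDerivAt_id (0 : ℝ)).const_mul 2).const_sub (-2 * p)
    exact (hn.div (hpoly 0) (by simpa using hq.ne')).congr_deriv (by simp; ring_nf)
  have := tendsto_symm_second_difference h1 h2
  refine this.congr fun s => ?_
  have e1 := hp s
  have e2 := hp (-s)
  rw [Complex.ofReal_neg, neg_mul, ← sub_eq_add_neg] at e2
  have e3 : R ^ 2 - ‖z + s * e‖ ^ 2 = q - 2 * p * s - s ^ 2 := by rw [e1, hqdef]; ring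
  have e4 : R ^ 2 - ‖z - s * e‖ ^ 2 = q - 2 * p * -s - (-s) ^ 2 := by rw [e2, hqdef]; ring
  have e5 : q - 2 * p * 0 - 0 ^ 2 = q := by ring
  rw [e3, e4, e5]

theorem tendsto_fivePoint_log_hyp {R c : ℝ} (hc : 0 < c) {z : ℂ} (hz : z ∈ ball (0 : ℂ) R) :
    Tendsto (fun s : ℝ => fivePoint (fun w => Real.log (c * hyp R w)) z s / s ^ 2)
      (nhdsWithin 0 (Ioi 0)) (nhds (hyp R z)) := by
  have hq := sq_sub_norm_sq_pos hz
  have hnorm : ∀ w : ℂ, ‖w‖ ^ 2 = w.re ^ 2 + w.im ^ 2 := fun w => by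
    rw [← Complex.normSq_eq_norm_sq, Complex.normSq_apply]; ring
  have h1 := tendsto_second_difference_log_disc hz 1 z.re fun s => by
    simp only [hnorm]; simp; ring
  have h2 := tendsto_second_difference_log_disc hz Complex.I z.im fun s => by
    simp only [hnorm]; simp; ring
  have h3 := (h1.add h2).const_mul (-2)
  have hval : -2 * ((-2 * (R ^ 2 - ‖z‖ ^ 2) - 4 * z.re ^ 2) / (R ^ 2 - ‖z‖ ^ 2) ^ 2 +
      (-2 * (R ^ 2 - ‖z‖ ^ 2) - 4 * z.im ^ 2) / (R ^ 2 - ‖z‖ ^ 2) ^ 2) = hyp R z := by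
    rw [hyp, ← add_div, ← mul_div_assoc]
    congr 1
    rw [hnorm]; ring
  rw [hval] at h3
  refine h3.congr' ?_
  have hlog : ∀ w ∈ ball (0 : ℂ) R, Real.log (c * hyp R w) =
      Real.log (c * (8 * R ^ 2)) - 2 * Real.log (R ^ 2 - ‖w‖ ^ 2) := fun w hw => by
    have hw' := sq_sub_norm_sq_pos hw
    have : 0 < R ^ 2 := by nlinarith [norm_nonneg w]
    rw [hyp, ← mul_div_assoc, Real.log_div (by positivity) (by positivity), Real.log_pow]
    norm_num
  have hin : ∀ e : ℂ, ∀ᶠ s : ℝ in nhdsWithin 0 (Ioi 0), z + s * e ∈ ball (0 : ℂ) R := fun e => by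
    have : Tendsto (fun s : ℝ => z + s * e) (nhds 0) (nhds z) := by
      have : Continuous fun s : ℝ => z + s * e := by fun_prop
      simpa using this.tendsto 0
    exact (this.eventually (isOpen_ball.mem_nhds hz)).filter_mono nhdsWithin_le_nhds
  filter_upwards [hin 1, hin (-1), hin Complex.I, hin (-Complex.I)] with s a1 a2 a3 a4
  rw [mul_neg, ← sub_eq_add_neg] at a2 a4
  simp only [fivePoint]
  rw [hlog _ hz, hlog _ a1, hlog _ a2, hlog _ a3, hlog _ a4]
  ring

/-- A sequence of positive functions increasing no faster than an implicit Euler scheme for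
logarithmic diffusion lies, in the final step, below the hyperbolic barrier weighted by the
exponential of a potential of the initial function. -/
theorem euler_harnack {X : ℕ → ℂ → ℝ} {Φ : ℂ → ℝ} {R δ ε d : ℝ} {N : ℕ} (hN : 1 ≤ N)
    (hδ : 0 < δ) (hXc : ∀ j ≤ N, ContinuousOn (X j) (closedBall 0 R))
    (hXpos : ∀ j ≤ N, ∀ z ∈ closedBall (0 : ℂ) R, 0 < X j z)
    (hXd : ∀ j ≤ N, ∀ z ∈ ball (0 : ℂ) R, ContDiffAt ℝ 2 (fun w => Real.log (X j w)) z)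
    (hX : ∀ j < N, ∀ z ∈ ball (0 : ℂ) R,
      X (j + 1) z - X j z ≤ δ * (lap (fun w => Real.log (X (j + 1) w)) z + ε))
    (hΦc : ContinuousOn Φ (closedBall 0 R)) (hΦ0 : ∀ z ∈ closedBall (0 : ℂ) R, 0 ≤ Φ z)
    (hΦ : ∀ z ∈ ball (0 : ℂ) R, ∀ᶠ s : ℝ in nhdsWithin 0 (Ioi 0),
      fivePoint Φ z s ≤ s ^ 2 * (-X 0 z + d))
    (hεn : 0 ≤ ε) (hsmall : N * δ * ε + d < N * δ * (8 / R ^ 2)) :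
    ∀ z ∈ ball (0 : ℂ) R,
      X N z ≤ 2 * Real.exp 1 * (N * δ) * hyp R z * Real.exp (Φ z / (N * δ)) := by
  have hNδ : 0 < N * δ := by positivity
  have hne : ∀ k, (Finset.Icc k (k ⊔ N)).Nonempty := fun k => Finset.nonempty_Icc.2 le_sup_left
  set m : ℕ → ℂ → ℝ := fun k z => (Finset.Icc k (k ⊔ N)).sup' (hne k) fun j => X j z / j with hm
  set g : ℂ → ℝ := fun z => Real.log (2 * (N * δ) * hyp R z) with hg
  set B : ℕ → ℂ → ℝ := fun n z => (∑ k ∈ Finset.Icc 1 n, δ * (Real.log (k * m k z) - g z)) - Φ z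
    with hB
  have hm_le : ∀ k j, k ≤ j → j ≤ N → ∀ z, X j z / j ≤ m k z := fun k j hkj hj z =>
    Finset.le_sup' (fun j => X j z / j) (Finset.mem_Icc.2 ⟨hkj, hj.trans le_sup_right⟩)
  have hm_ex : ∀ k, k ≤ N → ∀ z, ∃ j, k ≤ j ∧ j ≤ N ∧ m k z = X j z / j := fun k hk z => by
    obtain ⟨j, hj, hj'⟩ := Finset.exists_mem_eq_sup' (hne k) fun j => X j z / j
    rw [Finset.mem_Icc, sup_eq_right.2 hk] at hj
    exact ⟨j, hj.1, hj.2, hj'⟩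
  have hm_pos : ∀ k, 1 ≤ k → k ≤ N → ∀ z ∈ closedBall (0 : ℂ) R, 0 < m k z :=
    fun k hk hkN z hz => lt_of_lt_of_le (div_pos (hXpos k hkN z hz) (by exact_mod_cast hk))
      (hm_le k k le_rfl hkN z)
  have hm_cont : ∀ k ≤ N, ContinuousOn (m k) (closedBall 0 R) := fun k hk => by
    refine ContinuousOn.finset_sup'_apply (hne k) fun j hj => ?_
    rw [Finset.mem_Icc, sup_eq_right.2 hk] at hj
    exact (hXc j hj.2).div_const _
  have hg_cont : ContinuousOn g (ball 0 R) := by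
    refine ContinuousOn.log (continuousOn_const.mul (continuousOn_hyp R)) fun z hz => ?_
    have := hyp_pos hz
    positivity
  have hB_cont : ∀ n ≤ N, ContinuousOn (B n) (ball 0 R) := fun n hn => by
    refine ContinuousOn.sub (continuousOn_finsetSum _ fun k hk => ?_)
      (hΦc.mono ball_subset_closedBall)
    rw [Finset.mem_Icc] at hk
    refine continuousOn_const.mul (ContinuousOn.sub (ContinuousOn.log (continuousOn_const.mul
      ((hm_cont k (hk.2.trans hn)).mono ball_subset_closedBall)) fun z hz => ?_) hg_cont)
    have := hm_pos k hk.1 (hk.2.trans hn) z (ball_subset_closedBall hz)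
    have : (0 : ℝ) < k := by exact_mod_cast hk.1
    positivity
  -- a bound for all the functions on the closed ball
  obtain ⟨C, hC0, hC⟩ : ∃ C : ℝ, 0 < C ∧ ∀ j ≤ N, ∀ z ∈ closedBall (0 : ℂ) R, X j z ≤ C := by
    have : ∀ j, ∃ C : ℝ, j ≤ N → ∀ z ∈ closedBall (0 : ℂ) R, X j z ≤ C := fun j => by
      by_cases hj : j ≤ N
      · obtain ⟨C, hC⟩ := (isCompact_closedBall (0 : ℂ) R).bddAbove_image (hXc j hj)
        exact ⟨C, fun _ z hz => hC (mem_image_of_mem _ hz)⟩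
      · exact ⟨0, fun h => absurd h hj⟩
    choose C hC using this
    refine ⟨1 + ∑ j ∈ Finset.range (N + 1), |C j|, by positivity, fun j hj z hz => ?_⟩
    have := Finset.single_le_sum (f := fun j => |C j|) (fun i _ => abs_nonneg _)
      (Finset.mem_range.2 (Nat.lt_succ_of_le hj))
    have h2 := hC j hj z hz
    have h3 := le_abs_self (C j)
    linarith
  have hkm : ∀ k, 1 ≤ k → k ≤ N → ∀ z ∈ closedBall (0 : ℂ) R, k * m k z ≤ C :=
    fun k hk hkN z hz => by
    obtain ⟨j, hj1, hj2, hj⟩ := hm_ex k hkN z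
    have hj0 : (0 : ℝ) < j := by exact_mod_cast hk.trans hj1
    rw [hj, ← mul_div_assoc, div_le_iff₀ hj0]
    have h1 := hC j hj2 z hz
    have h2 := hXpos j hj2 z hz
    have h3 : (k : ℝ) ≤ j := by exact_mod_cast hj1
    nlinarith
  have key : ∀ z ∈ ball (0 : ℂ) R, B N z ≤ 0 := by
    by_contra! hcon
    obtain ⟨z₁, hz₁, hz₁'⟩ := hcon
    have hR : 0 < R := by
      have h : ‖z₁‖ < R := by simpa using hz₁
      exact (norm_nonneg _).trans_lt h
    -- the barrier dominates near the boundary circle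
    obtain ⟨ρ, hρR, hρ⟩ : ∃ ρ < R, ∀ z ∈ ball (0 : ℂ) R, ρ < ‖z‖ →
        C ≤ 2 * (N * δ) * hyp R z := by
      have hcont : Tendsto (fun ρ : ℝ => C * (R ^ 2 - ρ ^ 2) ^ 2) (nhdsWithin R (Iio R))
          (nhds 0) := by
        have : Continuous fun ρ : ℝ => C * (R ^ 2 - ρ ^ 2) ^ 2 := by fun_prop
        have := (this.tendsto R).mono_left (nhdsWithin_le_nhds (s := Iio R))
        simpa using this
      have hev := hcont.eventually (gt_mem_nhds
        (show (0 : ℝ) < 2 * (N * δ) * (8 * R ^ 2) by positivity))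
      obtain ⟨ρ, ⟨h1, h2⟩, h3⟩ := ((hev.and self_mem_nhdsWithin).and
        ((lt_mem_nhds hR).filter_mono nhdsWithin_le_nhds)).exists
      refine ⟨ρ, h2, fun z hz hρz => ?_⟩
      have hq := sq_sub_norm_sq_pos hz
      rw [hyp, ← mul_div_assoc, le_div_iff₀ (by positivity)]
      refine le_trans ?_ h1.le
      have : ρ ^ 2 ≤ ‖z‖ ^ 2 := pow_le_pow_left₀ h3.le hρz.le 2
      gcongr
    have hBneg : ∀ n ≤ N, ∀ z ∈ ball (0 : ℂ) R, ρ < ‖z‖ → B n z ≤ 0 := fun n hn z hz hρz => by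
      have h1 := hΦ0 z (ball_subset_closedBall hz)
      have h2 : ∑ k ∈ Finset.Icc 1 n, δ * (Real.log (k * m k z) - g z) ≤ 0 := by
        refine Finset.sum_nonpos fun k hk => ?_
        rw [Finset.mem_Icc] at hk
        have h3 := hkm k hk.1 (hk.2.trans hn) z (ball_subset_closedBall hz)
        have h4 := hm_pos k hk.1 (hk.2.trans hn) z (ball_subset_closedBall hz)
        have h5 : (0 : ℝ) < k := by exact_mod_cast hk.1
        have h6 : Real.log (k * m k z) ≤ g z :=
          Real.log_le_log (by positivity) (h3.trans (hρ z hz hρz))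
        nlinarith
      simp only [hB]
      linarith
    have hsub : closedBall (0 : ℂ) ρ ⊆ ball 0 R := closedBall_subset_ball hρR
    have hz₁ρ : z₁ ∈ closedBall (0 : ℂ) ρ := by
      by_contra h
      have : ρ < ‖z₁‖ := by simpa using h
      exact absurd (hBneg N le_rfl z₁ hz₁ this) (not_le.2 hz₁')
    have hmaxn : ∀ n, ∃ z ∈ closedBall (0 : ℂ) ρ, n ≤ N →
        ∀ w ∈ closedBall (0 : ℂ) ρ, B n w ≤ B n z := fun n => by
      by_cases hn : n ≤ N
      · obtain ⟨z, hz, hz'⟩ := (isCompact_closedBall (0 : ℂ) ρ).exists_isMaxOn ⟨z₁, hz₁ρ⟩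
          ((hB_cont n hn).mono hsub)
        exact ⟨z, hz, fun _ w hw => hz' hw⟩
      · exact ⟨z₁, hz₁ρ, fun h => absurd h hn⟩
    choose ζ hζ hζ' using hmaxn
    obtain ⟨n, hn, hnmax⟩ := Finset.exists_max_image (Finset.range (N + 1)) (fun n => B n (ζ n))
      ⟨0, by simp⟩
    have hnN : n ≤ N := Nat.lt_succ_iff.1 (Finset.mem_range.1 hn)
    set z₀ := ζ n with hz₀
    have hz₀R : z₀ ∈ ball (0 : ℂ) R := hsub (hζ n)
    have hz₀c := ball_subset_closedBall hz₀R
    have hpos : 0 < B n z₀ := hz₁'.trans_le ((hζ' N le_rfl z₁ hz₁ρ).trans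
      (hnmax N (Finset.self_mem_range_succ N)))
    have hglob : ∀ k ≤ N, ∀ w ∈ ball (0 : ℂ) R, B k w ≤ B n z₀ := fun k hk w hw => by
      by_cases hw' : ‖w‖ ≤ ρ
      · exact (hζ' k hk w (by simpa using hw')).trans
          (hnmax k (Finset.mem_range.2 (Nat.lt_succ_of_le hk)))
      · exact (hBneg k hk w hw (not_le.1 hw')).trans hpos.le
    have hn1 : 1 ≤ n := by
      by_contra h
      have : n = 0 := by omega
      have h0 := hΦ0 z₀ hz₀c
      rw [this] at hpos
      simp [hB] at hpos
      linarith
    have hσex : ∀ k, ∃ j, k ≤ N → k ≤ j ∧ j ≤ N ∧ m k z₀ = X j z₀ / j := fun k => by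
      by_cases hk : k ≤ N
      · obtain ⟨j, hj⟩ := hm_ex k hk z₀
        exact ⟨j, fun _ => hj⟩
      · exact ⟨0, fun h => absurd h hk⟩
    choose σ hσ using hσex
    have henv := envelope_le_sum_increments (x := fun j => X j z₀) (N := N) (σ := σ)
      (hXpos 0 (Nat.zero_le _) z₀ hz₀c).le (fun k _ hk => ⟨(hσ k hk).1, (hσ k hk).2.1⟩)
      (fun k _ hk j hkj hj => by rw [← (hσ k hk).2.2]; exact hm_le k j hkj hj z₀) n hn1 hnN
    rw [← (hσ n hnN).2.2] at henv
    -- comparison with the previous step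
    have hstep : 2 * (N * δ) * hyp R z₀ ≤ n * m n z₀ := by
      have h1 := hglob (n - 1) (by omega) z₀ hz₀R
      obtain ⟨l, rfl⟩ : ∃ l, n = l + 1 := ⟨n - 1, by omega⟩
      simp only [hB, Nat.add_sub_cancel] at h1
      rw [Finset.sum_Icc_succ_top (by omega)] at h1
      have h2 : 0 ≤ δ * (Real.log (↑(l + 1) * m (l + 1) z₀) - g z₀) := by linarith
      have h3 : g z₀ ≤ Real.log (↑(l + 1) * m (l + 1) z₀) := by
        have := nonneg_of_mul_nonneg_right h2 hδ
        linarith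
      have h4 := hm_pos (l + 1) hn1 hnN z₀ hz₀c
      have h5 := hyp_pos hz₀R
      exact (Real.log_le_log_iff (by positivity) (by positivity)).1 h3
    -- second order comparison in space
    have hlap : ∑ k ∈ Finset.Icc 1 n, δ * (lap (fun w => Real.log (X (σ k) w)) z₀ - hyp R z₀) ≤
        -X 0 z₀ + d := by
      have hlim : Tendsto (fun s : ℝ => ∑ k ∈ Finset.Icc 1 n,
          δ * (fivePoint (fun w => Real.log (X (σ k) w)) z₀ s / s ^ 2 -
            fivePoint g z₀ s / s ^ 2)) (nhdsWithin 0 (Ioi 0))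
          (nhds (∑ k ∈ Finset.Icc 1 n,
            δ * (lap (fun w => Real.log (X (σ k) w)) z₀ - hyp R z₀))) := by
        refine tendsto_finsetSum _ fun k hk => ?_
        rw [Finset.mem_Icc] at hk
        exact ((tendsto_fivePoint (hXd (σ k) (hσ k (hk.2.trans hnN)).2.1 z₀ hz₀R)).sub
          (tendsto_fivePoint_log_hyp (by positivity) hz₀R)).const_mul δ
      refine le_of_tendsto hlim ?_
      set F : ℂ → ℝ := fun w => ∑ k ∈ Finset.Icc 1 n,
        δ * (Real.log (X (σ k) w) + Real.log (k / σ k) - g w) with hF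
      have hFB : ∀ w ∈ ball (0 : ℂ) R, F w - Φ w ≤ B n w := fun w hw => by
        refine sub_le_sub_right (Finset.sum_le_sum fun k hk => ?_) _
        rw [Finset.mem_Icc] at hk
        obtain ⟨s1, s2, -⟩ := hσ k (hk.2.trans hnN)
        have hk0 : (0 : ℝ) < k := by exact_mod_cast hk.1
        have hs0 : (0 : ℝ) < σ k := by exact_mod_cast hk.1.trans s1
        have hXp := hXpos (σ k) s2 w (ball_subset_closedBall hw)
        rw [← Real.log_mul hXp.ne' (by positivity)]
        refine mul_le_mul_of_nonneg_left (sub_le_sub_right (Real.log_le_log (by positivity) ?_) _)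
          hδ.le
        have := mul_le_mul_of_nonneg_left (hm_le k (σ k) s1 s2 w) hk0.le
        refine le_trans (le_of_eq ?_) this
        ring
      have hFB0 : F z₀ - Φ z₀ = B n z₀ := by
        simp only [hF, hB]
        congr 1
        refine Finset.sum_congr rfl fun k hk => ?_
        rw [Finset.mem_Icc] at hk
        obtain ⟨s1, s2, s3⟩ := hσ k (hk.2.trans hnN)
        have hk0 : (0 : ℝ) < k := by exact_mod_cast hk.1
        have hs0 : (0 : ℝ) < σ k := by exact_mod_cast hk.1.trans s1
        have hXp := hXpos (σ k) s2 z₀ hz₀c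
        rw [← Real.log_mul hXp.ne' (by positivity), s3]
        congr 3
        ring
      have hle : ∀ w ∈ ball (0 : ℂ) R, F w - F z₀ ≤ Φ w - Φ z₀ := fun w hw => by
        have := (hFB w hw).trans (hglob n hnN w hw)
        linarith
      have hin : ∀ e : ℂ, ∀ᶠ s : ℝ in nhdsWithin 0 (Ioi 0), z₀ + s * e ∈ ball (0 : ℂ) R :=
        fun e => by
        have : Tendsto (fun s : ℝ => z₀ + s * e) (nhds 0) (nhds z₀) := by
          have : Continuous fun s : ℝ => z₀ + s * e := by fun_prop
          simpa using this.tendsto 0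
        exact (this.eventually (isOpen_ball.mem_nhds hz₀R)).filter_mono nhdsWithin_le_nhds
      filter_upwards [hin 1, hin (-1), hin Complex.I, hin (-Complex.I), hΦ z₀ hz₀R,
        self_mem_nhdsWithin] with s a1 a2 a3 a4 a5 a6
      have hs : 0 < s := a6
      rw [mul_neg, ← sub_eq_add_neg] at a2 a4
      have hFs : fivePoint F z₀ s ≤ s ^ 2 * (-X 0 z₀ + d) := by
        refine le_trans ?_ a5
        have b1 := hle _ a1
        have b2 := hle _ a2
        have b3 := hle _ a3
        have b4 := hle _ a4
        simp only [fivePoint]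
        linarith
      have hFsum : ∑ k ∈ Finset.Icc 1 n,
          δ * (fivePoint (fun w => Real.log (X (σ k) w)) z₀ s / s ^ 2 -
            fivePoint g z₀ s / s ^ 2) = fivePoint F z₀ s / s ^ 2 := by
        simp only [hF, fivePoint, Finset.mul_sum, ← Finset.sum_add_distrib,
          ← Finset.sum_sub_distrib, Finset.sum_div]
        refine Finset.sum_congr rfl fun k _ => ?_
        ring
      rw [hFsum, div_le_iff₀ (by positivity)]
      linarith
    have hsum : ∑ k ∈ Finset.Icc 1 n, (X (σ k) z₀ - X (σ k - 1) z₀) ≤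
        ∑ k ∈ Finset.Icc 1 n, (δ * (lap (fun w => Real.log (X (σ k) w)) z₀ - hyp R z₀) +
          δ * (hyp R z₀ + ε)) := by
      refine Finset.sum_le_sum fun k hk => ?_
      rw [Finset.mem_Icc] at hk
      obtain ⟨s1, s2, -⟩ := hσ k (hk.2.trans hnN)
      obtain ⟨l, hl⟩ : ∃ l, σ k = l + 1 := ⟨σ k - 1, by omega⟩
      rw [hl, Nat.add_sub_cancel]
      have := hX l (by omega) z₀ hz₀R
      linarith
    rw [Finset.sum_add_distrib, Finset.sum_const, Nat.card_Icc, Nat.add_sub_cancel,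
      nsmul_eq_mul] at hsum
    have hh := hyp_lower hz₀R
    have hh' := hyp_pos hz₀R
    have hnδ : n * (δ * (hyp R z₀ + ε)) ≤ N * (δ * (hyp R z₀ + ε)) := by
      have : (n : ℝ) ≤ N := by exact_mod_cast hnN
      gcongr
    have := mul_le_mul_of_nonneg_left hh hNδ.le
    nlinarith
  intro z hz
  have hzc := ball_subset_closedBall hz
  have hXN := hXpos N le_rfl z hzc
  have hyp0 := hyp_pos hz
  have hN0 : (0 : ℝ) < N := by exact_mod_cast hN
  have h1 := key z hz
  have h2 : N * Real.log (X N z) - N ≤ ∑ k ∈ Finset.Icc 1 N, Real.log (k * m k z) := by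
    have h3 : ∑ k ∈ Finset.Icc 1 N, (Real.log (X N z) + (Real.log k - Real.log N)) ≤
        ∑ k ∈ Finset.Icc 1 N, Real.log (k * m k z) := by
      refine Finset.sum_le_sum fun k hk => ?_
      rw [Finset.mem_Icc] at hk
      have hk0 : (0 : ℝ) < k := by exact_mod_cast hk.1
      rw [← Real.log_div hk0.ne' hN0.ne', ← Real.log_mul hXN.ne' (by positivity)]
      refine Real.log_le_log (by positivity) ?_
      have := mul_le_mul_of_nonneg_left (hm_le k N hk.2 le_rfl z) hk0.le
      exact le_trans (le_of_eq (by ring)) this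
    have h4 : ∀ n : ℕ, ∑ k ∈ Finset.Icc 1 n, Real.log k = Real.log (n.factorial) := fun n => by
      induction n with
      | zero => simp
      | succ n ih =>
        have hf : (n.factorial : ℝ) ≠ 0 := by exact_mod_cast n.factorial_ne_zero
        have hn : (↑(n + 1) : ℝ) ≠ 0 := by positivity
        rw [Finset.sum_Icc_succ_top (by omega), ih, Nat.factorial_succ, Nat.cast_mul,
          Real.log_mul hn hf, add_comm]
    have h5 : N * Real.log N - N ≤ Real.log (N.factorial) := by
      have h6 := Real.pow_div_factorial_le_exp (x := N) hN0.le N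
      have hf : (0 : ℝ) < N.factorial := by exact_mod_cast N.factorial_pos
      have h7 := Real.log_le_log (by positivity) h6
      rw [Real.log_exp, Real.log_div (by positivity) (by positivity), Real.log_pow] at h7
      linarith
    rw [Finset.sum_add_distrib, Finset.sum_sub_distrib, h4] at h3
    simp only [Finset.sum_const, Nat.card_Icc, Nat.add_sub_cancel, nsmul_eq_mul] at h3
    linarith
  simp only [hB] at h1
  rw [← Finset.mul_sum, Finset.sum_sub_distrib] at h1
  simp only [Finset.sum_const, Nat.card_Icc, Nat.add_sub_cancel, nsmul_eq_mul] at h1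
  have h3 := mul_le_mul_of_nonneg_left h2 hδ.le
  have h4 : Real.log (X N z) ≤ 1 + g z + Φ z / (N * δ) := by
    rw [← sub_le_iff_le_add', le_div_iff₀ hNδ]
    linarith
  have h5 := Real.exp_le_exp.2 h4
  rw [Real.exp_log hXN, Real.exp_add, Real.exp_add, Real.exp_log (by positivity)] at h5
  refine h5.trans (le_of_eq ?_)
  ring

/-- `u` is a smooth positive solution of `∂u/∂t = Δ log u` on the cylinder
`ball 0 ρ × (0, T)`. -/
structure LogDiffusion (ρ T : ℝ) (u : ℂ → ℝ → ℝ) : Prop where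
  pos : ∀ p ∈ ball (0 : ℂ) ρ ×ˢ Ioo (0 : ℝ) T, 0 < u p.1 p.2
  smooth : ContDiffOn ℝ (⊤ : ℕ∞) (fun p : ℂ × ℝ => u p.1 p.2) (ball (0 : ℂ) ρ ×ˢ Ioo (0 : ℝ) T)
  pde : ∀ p ∈ ball (0 : ℂ) ρ ×ˢ Ioo (0 : ℝ) T,
    deriv (u p.1) p.2 = lap (fun z => Real.log (u z p.2)) p.1

namespace LogDiffusion

variable {ρ T : ℝ} {u : ℂ → ℝ → ℝ}

theorem contDiffAt (h : LogDiffusion ρ T u) {z : ℂ} {t : ℝ} (hz : z ∈ ball (0 : ℂ) ρ)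
    (ht : t ∈ Ioo 0 T) : ContDiffAt ℝ (⊤ : ℕ∞) (fun p : ℂ × ℝ => u p.1 p.2) (z, t) :=
  h.smooth.contDiffAt ((isOpen_ball.prod isOpen_Ioo).mem_nhds ⟨hz, ht⟩)

theorem contDiffAt_slice (h : LogDiffusion ρ T u) {z : ℂ} {t : ℝ} (hz : z ∈ ball (0 : ℂ) ρ)
    (ht : t ∈ Ioo 0 T) : ContDiffAt ℝ (⊤ : ℕ∞) (fun w => u w t) z :=
  (h.contDiffAt hz ht).comp (f := fun w : ℂ => (w, t)) z (contDiffAt_id.prodMk contDiffAt_const)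

theorem continuousOn_slice (h : LogDiffusion ρ T u) {t : ℝ} (ht : t ∈ Ioo 0 T) :
    ContinuousOn (fun w => u w t) (ball 0 ρ) :=
  fun _ hz => (h.contDiffAt_slice hz ht).continuousAt.continuousWithinAt

theorem contDiffAt_log (h : LogDiffusion ρ T u) {z : ℂ} {t : ℝ} (hz : z ∈ ball (0 : ℂ) ρ)
    (ht : t ∈ Ioo 0 T) : ContDiffAt ℝ 2 (fun w => Real.log (u w t)) z :=
  ((h.contDiffAt_slice hz ht).of_le (WithTop.coe_le_coe.2 le_top)).log (h.pos (z, t) ⟨hz, ht⟩).ne'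

theorem hasDerivAt (h : LogDiffusion ρ T u) {z : ℂ} {t : ℝ} (hz : z ∈ ball (0 : ℂ) ρ)
    (ht : t ∈ Ioo 0 T) :
    HasDerivAt (u z) (fderiv ℝ (fun p : ℂ × ℝ => u p.1 p.2) (z, t) (0, 1)) t :=
  ((h.contDiffAt hz ht).differentiableAt (by simp)).hasFDerivAt.comp_hasDerivAt t
    ((hasDerivAt_const t z).prodMk (hasDerivAt_id t))

theorem continuousOn_deriv (h : LogDiffusion ρ T u) :
    ContinuousOn (fun p : ℂ × ℝ => deriv (u p.1) p.2) (ball (0 : ℂ) ρ ×ˢ Ioo (0 : ℝ) T) := by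
  have h1 : ContinuousOn (fun p : ℂ × ℝ => fderiv ℝ (fun p : ℂ × ℝ => u p.1 p.2) p (0, 1))
      (ball (0 : ℂ) ρ ×ˢ Ioo (0 : ℝ) T) :=
    (h.smooth.continuousOn_fderiv_of_isOpen (isOpen_ball.prod isOpen_Ioo) (by simp)).clm_apply
      continuousOn_const
  exact h1.congr fun p hp => (h.hasDerivAt hp.1 hp.2).deriv

/-- Uniform backward Euler estimate on compact subcylinders. -/
theorem exists_euler_step (h : LogDiffusion ρ T u) {R a b ε : ℝ} (hR : R < ρ) (ha : 0 < a)
    (hab : a < b) (hb : b < T) (hε : 0 < ε) :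
    ∃ N : ℕ, 1 ≤ N ∧ ∀ z ∈ closedBall (0 : ℂ) R, ∀ j < N,
      u z (a + (j + 1 : ℕ) * ((b - a) / N)) - u z (a + j * ((b - a) / N)) ≤
        (b - a) / N * (lap (fun w => Real.log (u w (a + (j + 1 : ℕ) * ((b - a) / N)))) z + ε) := by
  have hsub : closedBall (0 : ℂ) R ×ˢ Icc a b ⊆ ball (0 : ℂ) ρ ×ˢ Ioo (0 : ℝ) T :=
    prod_mono (closedBall_subset_ball hR) (Icc_subset_Ioo ha hb)
  have huc := ((isCompact_closedBall (0 : ℂ) R).prod (isCompact_Icc (a := a)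
    (b := b))).uniformContinuousOn_of_continuous (h.continuousOn_deriv.mono hsub)
  obtain ⟨η, hη, hη'⟩ := Metric.uniformContinuousOn_iff.1 huc ε hε
  obtain ⟨N, hN⟩ := exists_nat_gt ((b - a) / η)
  have hba : 0 < b - a := sub_pos.2 hab
  have hN0 : (0 : ℝ) < N := (div_pos hba hη).trans hN
  refine ⟨N, by exact_mod_cast hN0, fun z hz j hj => ?_⟩
  set δ := (b - a) / N with hδ
  have hδ0 : 0 < δ := div_pos hba hN0
  have hδη : δ < η := by
    rw [hδ, div_lt_iff₀ hN0]
    rw [div_lt_iff₀ hη] at hN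
    linarith
  have hNδ : N * δ = b - a := by rw [hδ]; field_simp
  have hj1 : ((j + 1 : ℕ) : ℝ) ≤ N := by exact_mod_cast hj
  push_cast at hj1 ⊢
  have hj0 : (0 : ℝ) ≤ j := Nat.cast_nonneg j
  have hlt : a + j * δ < a + (j + 1) * δ := by nlinarith
  have hlow : a ≤ a + j * δ := by nlinarith
  have hup : a + (j + 1) * δ ≤ b := by nlinarith
  have hmem : ∀ t ∈ Icc (a + j * δ) (a + (j + 1) * δ), (z, t) ∈ closedBall (0 : ℂ) R ×ˢ Icc a b :=
    fun t ht => ⟨hz, hlow.trans ht.1, ht.2.trans hup⟩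
  obtain ⟨ξ, hξ, hξ'⟩ := exists_hasDerivAt_eq_slope (u z) (deriv (u z)) hlt
    (fun t ht => (h.hasDerivAt (hsub (hmem t ht)).1
      (hsub (hmem t ht)).2).continuousAt.continuousWithinAt)
    (fun t ht => (h.hasDerivAt (hsub (hmem t (Ioo_subset_Icc_self ht))).1
      (hsub (hmem t (Ioo_subset_Icc_self ht))).2).differentiableAt.hasDerivAt)
  have hend := hmem _ (right_mem_Icc.2 hlt.le)
  rw [← h.pde (z, a + (j + 1) * δ) (hsub hend)]
  have hwid : a + (j + 1) * δ - (a + j * δ) = δ := by ring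
  rw [hwid, eq_div_iff hδ0.ne'] at hξ'
  have hdist := hη' (z, ξ) (hmem ξ (Ioo_subset_Icc_self hξ)) (z, a + (j + 1) * δ) hend (by
    rw [Prod.dist_eq, dist_self, Real.dist_eq, max_lt_iff]
    refine ⟨hη, abs_lt.2 ⟨?_, ?_⟩⟩ <;> linarith [hξ.1, hξ.2])
  rw [Real.dist_eq] at hdist
  have := (abs_lt.1 hdist).2
  simp only at this ⊢
  rw [← hξ', mul_comm]
  exact mul_le_mul_of_nonneg_left (by linarith) hδ0.le

theorem harnack (h : LogDiffusion ρ T u) {R a b d : ℝ} {Φ : ℂ → ℝ} (hR0 : 0 < R) (hR : R < ρ)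
    (ha : 0 < a) (hab : a < b) (hb : b < T) (hΦc : ContinuousOn Φ (closedBall 0 R))
    (hΦ0 : ∀ z ∈ closedBall (0 : ℂ) R, 0 ≤ Φ z) (hd : d < (b - a) * (8 / R ^ 2))
    (hΦ : ∀ z ∈ ball (0 : ℂ) R, ∀ᶠ s : ℝ in nhdsWithin 0 (Ioi 0),
      fivePoint Φ z s ≤ s ^ 2 * (-u z a + d)) :
    ∀ z ∈ ball (0 : ℂ) R,
      u z b ≤ 2 * Real.exp 1 * (b - a) * hyp R z * Real.exp (Φ z / (b - a)) := by
  have hba : 0 < b - a := sub_pos.2 hab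
  obtain ⟨ε, hε0, hε⟩ : ∃ ε, 0 < ε ∧ (b - a) * ε + d < (b - a) * (8 / R ^ 2) := by
    refine ⟨((b - a) * (8 / R ^ 2) - d) / (2 * (b - a)),
      div_pos (by linarith) (by positivity), ?_⟩
    have : (b - a) * (((b - a) * (8 / R ^ 2) - d) / (2 * (b - a))) =
        ((b - a) * (8 / R ^ 2) - d) / 2 := by field_simp
    linarith
  obtain ⟨N, hN, hstep⟩ := h.exists_euler_step hR ha hab hb hε0
  have hN0 : (0 : ℝ) < N := by exact_mod_cast hN
  set δ := (b - a) / N with hδ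
  have hδ0 : 0 < δ := div_pos hba hN0
  have hNδ : N * δ = b - a := by rw [hδ]; field_simp
  have htime : ∀ j ≤ N, a + j * δ ∈ Ioo 0 T := fun j hj => by
    have h1 : (j : ℝ) ≤ N := by exact_mod_cast hj
    have h0 : (0 : ℝ) ≤ j := Nat.cast_nonneg j
    constructor <;> nlinarith
  have hsub := closedBall_subset_ball (x := (0 : ℂ)) hR
  have := euler_harnack (X := fun j z => u z (a + j * δ)) (Φ := Φ) (R := R) (δ := δ) (ε := ε)
    (d := d) hN hδ0 (fun j hj => (h.continuousOn_slice (htime j hj)).mono hsub)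
    (fun j hj z hz => h.pos (z, _) ⟨hsub hz, htime j hj⟩)
    (fun j hj z hz => h.contDiffAt_log (hsub (ball_subset_closedBall hz)) (htime j hj))
    (fun j hj z hz => hstep z (ball_subset_closedBall hz) j hj)
    hΦc hΦ0 (by simpa using hΦ) hε0.le (by rw [hNδ]; exact hε)
  simp only [hNδ] at this
  simpa using this

end LogDiffusion

theorem integral_ball_radial (F : ℝ → ℝ) {κ : ℝ} (hκ : 0 ≤ κ) :
    ∫ x in ball (0 : ℂ) κ, F ‖x‖ = 2 * Real.pi * ∫ y in (0 : ℝ)..κ, y * F y := by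
  have h1 : ∀ x : ℂ, (ball (0 : ℂ) κ).indicator (fun x => F ‖x‖) x =
      (Iio κ).indicator F ‖x‖ := fun x => by
    by_cases hx : ‖x‖ < κ
    · rw [indicator_of_mem (by simpa using hx), indicator_of_mem (by simpa using hx)]
    · rw [indicator_of_notMem (by simpa using hx), indicator_of_notMem (by simpa using hx)]
  rw [← integral_indicator measurableSet_ball, integral_congr_ae (Eventually.of_forall h1),
    integral_fun_norm_addHaar volume ((Iio κ).indicator F), Complex.finrank_real_complex]
  have h2 : ∀ y : ℝ, y ^ (2 - 1) • (Iio κ).indicator F y =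
      (Iio κ).indicator (fun y => y * F y) y := fun y => by
    by_cases hy : y ∈ Iio κ <;> simp [hy]
  simp only [h2]
  rw [setIntegral_indicator measurableSet_Iio, Ioi_inter_Iio, ← integral_Ioc_eq_integral_Ioo,
    ← intervalIntegral.integral_of_le hκ]
  simp [Measure.real, Complex.volume_ball, mul_assoc]

theorem integral_ball_mollifier {ε κ : ℝ} (hε : 0 < ε) (hκ : 0 ≤ κ) :
    ∫ x in ball (0 : ℂ) κ, ε ^ 2 / (‖x‖ ^ 2 + ε ^ 2) ^ 2 =
      Real.pi * (κ ^ 2 / (κ ^ 2 + ε ^ 2)) := by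
  rw [integral_ball_radial (fun y => ε ^ 2 / (y ^ 2 + ε ^ 2) ^ 2) hκ]
  have h : ∀ y ∈ uIcc 0 κ, HasDerivAt (fun y : ℝ => -(ε ^ 2 / 2) * (y ^ 2 + ε ^ 2)⁻¹)
      (y * (ε ^ 2 / (y ^ 2 + ε ^ 2) ^ 2)) y := fun y _ => by
    have hne : y ^ 2 + ε ^ 2 ≠ 0 := by positivity
    refine ((((hasDerivAt_pow 2 y).add_const (ε ^ 2)).inv hne).const_mul
      (-(ε ^ 2 / 2))).congr_deriv ?_
    field_simp
    simp
  rw [intervalIntegral.integral_eq_sub_of_hasDerivAt h]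
  · have : κ ^ 2 + ε ^ 2 ≠ 0 := by positivity
    field_simp
    ring
  · refine Continuous.intervalIntegrable ?_ _ _
    have hne : ∀ y : ℝ, (y ^ 2 + ε ^ 2) ^ 2 ≠ 0 := fun y =>
      pow_ne_zero 2 (add_pos_of_nonneg_of_pos (sq_nonneg y) (pow_pos hε 2)).ne'
    exact continuous_id.mul (continuous_const.div (by fun_prop) hne)

/-- The logarithmic kernel regularised at scale `ε`. -/
noncomputable def logKernel (c ε : ℝ) (x : ℂ) : ℝ :=
  Real.log (c / (‖x‖ ^ 2 + ε ^ 2)) / (4 * Real.pi)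

theorem continuous_logKernel {c ε : ℝ} (hc : 0 < c) (hε : 0 < ε) : Continuous (logKernel c ε) := by
  have : ∀ x : ℂ, ‖x‖ ^ 2 + ε ^ 2 ≠ 0 := fun x => by positivity
  exact (Continuous.log (continuous_const.div (by fun_prop) this)
    fun x => div_ne_zero hc.ne' (this x)).div_const _

theorem logKernel_nonneg {c ε : ℝ} {x : ℂ} (hε : 0 < ε) (hx : ‖x‖ ^ 2 + ε ^ 2 ≤ c) :
    0 ≤ logKernel c ε x := by
  refine div_nonneg (Real.log_nonneg ?_) (by positivity)
  rwa [one_le_div (by positivity)]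

theorem log_fivePoint_lower {ε s : ℝ} (hε : 0 < ε) (hs : 0 < s) (hsε : s ≤ ε) (p q : ℝ) :
    4 * s ^ 2 * (ε ^ 2 / (p ^ 2 + q ^ 2 + ε ^ 2) ^ 2) - 18 * (s ^ 4 / ε ^ 4) ≤
      Real.log ((p + s) ^ 2 + q ^ 2 + ε ^ 2) + Real.log ((p - s) ^ 2 + q ^ 2 + ε ^ 2) +
      Real.log (p ^ 2 + (q + s) ^ 2 + ε ^ 2) + Real.log (p ^ 2 + (q - s) ^ 2 + ε ^ 2) -
      4 * Real.log (p ^ 2 + q ^ 2 + ε ^ 2) := by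
  set A := p ^ 2 + q ^ 2 + ε ^ 2 with hA
  have hA0 : 0 < A := by positivity
  have hAε : ε ^ 2 ≤ A := by nlinarith [sq_nonneg p, sq_nonneg q]
  have hs2 : s ^ 2 ≤ ε ^ 2 := by gcongr
  set y := (4 * s ^ 2 * ε ^ 2 - 2 * s ^ 4) / A ^ 2 with hy
  have hy0 : 0 ≤ y := by
    refine div_nonneg ?_ (by positivity)
    nlinarith [sq_nonneg s]
  have hy1 : y ≤ 4 * s ^ 2 / ε ^ 2 := by
    rw [hy, div_le_div_iff₀ (by positivity) (by positivity)]
    have : (ε ^ 2) ^ 2 ≤ A ^ 2 := by gcongr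
    have h4 : (4 * s ^ 2 * ε ^ 2 - 2 * s ^ 4) ≤ 4 * s ^ 2 * ε ^ 2 := by nlinarith [sq_nonneg (s ^ 2)]
    calc (4 * s ^ 2 * ε ^ 2 - 2 * s ^ 4) * ε ^ 2 ≤ 4 * s ^ 2 * ε ^ 2 * ε ^ 2 := by gcongr
      _ = 4 * s ^ 2 * (ε ^ 2) ^ 2 := by ring
      _ ≤ 4 * s ^ 2 * A ^ 2 := by gcongr
  have P1 : 0 < (p + s) ^ 2 + q ^ 2 + ε ^ 2 := by positivity
  have P2 : 0 < (p - s) ^ 2 + q ^ 2 + ε ^ 2 := by positivity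
  have P3 : 0 < p ^ 2 + (q + s) ^ 2 + ε ^ 2 := by positivity
  have P4 : 0 < p ^ 2 + (q - s) ^ 2 + ε ^ 2 := by positivity
  have hprod : A ^ 4 * (1 + y) ≤ ((p + s) ^ 2 + q ^ 2 + ε ^ 2) * ((p - s) ^ 2 + q ^ 2 + ε ^ 2) *
      (p ^ 2 + (q + s) ^ 2 + ε ^ 2) * (p ^ 2 + (q - s) ^ 2 + ε ^ 2) := by
    have e1 : A ^ 4 * (1 + y) = A ^ 4 + A ^ 2 * (4 * s ^ 2 * ε ^ 2 - 2 * s ^ 4) := by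
      rw [hy]; field_simp
    have e2 : ((p + s) ^ 2 + q ^ 2 + ε ^ 2) * ((p - s) ^ 2 + q ^ 2 + ε ^ 2) *
        (p ^ 2 + (q + s) ^ 2 + ε ^ 2) * (p ^ 2 + (q - s) ^ 2 + ε ^ 2) =
        (A ^ 2 - s ^ 4) ^ 2 + 4 * s ^ 2 * ε ^ 2 * (A + s ^ 2) ^ 2 +
          16 * s ^ 4 * p ^ 2 * q ^ 2 := by
      rw [hA]; ring
    rw [e1, e2]
    have : A ^ 2 ≤ (A + s ^ 2) ^ 2 := by gcongr; nlinarith [sq_nonneg s]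
    have h5 : 4 * s ^ 2 * ε ^ 2 * A ^ 2 ≤ 4 * s ^ 2 * ε ^ 2 * (A + s ^ 2) ^ 2 := by gcongr
    have h6 : 0 ≤ 16 * s ^ 4 * p ^ 2 * q ^ 2 := by positivity
    nlinarith [sq_nonneg (s ^ 4)]
  have hlog := Real.log_le_log (by positivity) hprod
  rw [Real.log_mul (by positivity) P4.ne', Real.log_mul (by positivity) P3.ne',
    Real.log_mul P1.ne' P2.ne', Real.log_mul (by positivity) (by positivity), Real.log_pow] at hlog
  push_cast at hlog
  have hlogy : y - y ^ 2 ≤ Real.log (1 + y) := by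
    refine le_trans ?_ (Real.one_sub_inv_le_log_of_pos (by positivity))
    have : 1 - (1 + y)⁻¹ = y / (1 + y) := by field_simp; ring
    rw [this, le_div_iff₀ (by positivity)]
    nlinarith [pow_nonneg hy0 3]
  have hysq : y ^ 2 ≤ 16 * s ^ 4 / ε ^ 4 := by
    calc y ^ 2 ≤ (4 * s ^ 2 / ε ^ 2) ^ 2 := by gcongr
      _ = 16 * s ^ 4 / ε ^ 4 := by rw [div_pow]; ring
  have hylow : 4 * s ^ 2 * (ε ^ 2 / A ^ 2) - 2 * s ^ 4 / ε ^ 4 ≤ y := by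
    have e1 : y = 4 * s ^ 2 * (ε ^ 2 / A ^ 2) - 2 * s ^ 4 / A ^ 2 := by rw [hy]; ring
    have : 2 * s ^ 4 / A ^ 2 ≤ 2 * s ^ 4 / ε ^ 4 := by
      have : ε ^ 4 ≤ A ^ 2 := by
        calc ε ^ 4 = (ε ^ 2) ^ 2 := by ring
          _ ≤ A ^ 2 := by gcongr
      gcongr
    linarith
  have e1 : 16 * s ^ 4 / ε ^ 4 = 16 * (s ^ 4 / ε ^ 4) := by ring
  have e2 : 2 * s ^ 4 / ε ^ 4 = 2 * (s ^ 4 / ε ^ 4) := by ring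
  linarith

theorem fivePoint_logKernel_le {c ε s : ℝ} (hc : 0 < c) (hε : 0 < ε) (hs : 0 < s) (hsε : s ≤ ε)
    (x : ℂ) : fivePoint (logKernel c ε) x s ≤
      -(s ^ 2 / Real.pi) * (ε ^ 2 / (‖x‖ ^ 2 + ε ^ 2) ^ 2) + 2 * s ^ 4 / ε ^ 4 := by
  have hnorm : ∀ w : ℂ, ‖w‖ ^ 2 = w.re ^ 2 + w.im ^ 2 := fun w => by
    rw [← Complex.normSq_eq_norm_sq, Complex.normSq_apply]; ring
  have hπ := Real.pi_pos
  have hk : ∀ w : ℂ, logKernel c ε w =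
      (Real.log c - Real.log (w.re ^ 2 + w.im ^ 2 + ε ^ 2)) / (4 * Real.pi) := fun w => by
    rw [logKernel, hnorm, Real.log_div hc.ne' (by positivity)]
  simp only [fivePoint, hk]
  rw [hnorm]
  simp only [mul_one, Complex.add_re, Complex.add_im, Complex.sub_re, Complex.sub_im,
    Complex.ofReal_re, Complex.ofReal_im, Complex.mul_re, Complex.mul_im, Complex.I_re,
    Complex.I_im, mul_zero, sub_zero, add_zero]
  generalize x.re = p
  generalize x.im = q
  have hfin := log_fivePoint_lower hε hs hsε p q
  set A := p ^ 2 + q ^ 2 + ε ^ 2 with hA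
  have hA0 : 0 < A := by positivity
  have hX : 0 ≤ s ^ 4 / ε ^ 4 := by positivity
  have hgoal : -(4 * s ^ 2 * (ε ^ 2 / A ^ 2) - 18 * (s ^ 4 / ε ^ 4)) / (4 * Real.pi) ≤
      -(s ^ 2 / Real.pi) * (ε ^ 2 / A ^ 2) + 2 * s ^ 4 / ε ^ 4 := by
    have e1 : -(4 * s ^ 2 * (ε ^ 2 / A ^ 2) - 18 * (s ^ 4 / ε ^ 4)) / (4 * Real.pi) =
        -(s ^ 2 / Real.pi) * (ε ^ 2 / A ^ 2) + 18 * (s ^ 4 / ε ^ 4) / (4 * Real.pi) := by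
      field_simp; ring
    rw [e1, mul_div_assoc 2]
    gcongr
    rw [div_le_iff₀ (by positivity)]
    nlinarith [Real.pi_gt_three]
  have hdiv := div_le_div_of_nonneg_right (neg_le_neg hfin)
    (show 0 ≤ 4 * Real.pi by positivity)
  clear_value A
  refine le_trans (le_of_eq ?_) (hdiv.trans hgoal)
  ring

/-- The regularised logarithmic potential of the restriction of `f` to `ball 0 R`. -/
noncomputable def logPotential (c ε R : ℝ) (f : ℂ → ℝ) (z : ℂ) : ℝ :=
  ∫ y in ball (0 : ℂ) R, logKernel c ε (z - y) * f y

theorem integrableOn_ball_mul {R : ℝ} {f k : ℂ → ℝ} (hf : ContinuousOn f (closedBall 0 R))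
    (hk : Continuous k) : IntegrableOn (fun y => k y * f y) (ball (0 : ℂ) R) :=
  ((hk.continuousOn.mul hf).integrableOn_compact (isCompact_closedBall _ _)).mono_set
    ball_subset_closedBall

theorem continuousOn_logPotential {c ε R : ℝ} {f : ℂ → ℝ} (hc : 0 < c) (hε : 0 < ε)
    (hf : ContinuousOn f (closedBall 0 R)) (S : ℝ) :
    ContinuousOn (logPotential c ε R f) (closedBall 0 S) := by
  have hk := continuous_logKernel hc hε
  obtain ⟨C, hC⟩ := (isCompact_closedBall (0 : ℂ) (S + R)).exists_bound_of_continuousOn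
    hk.continuousOn
  refine continuousOn_of_dominated (bound := fun y => C * |f y|) ?_ ?_ ?_ ?_
  · intro z _
    exact (integrableOn_ball_mul hf (hk.comp (continuous_const.sub continuous_id))).1
  · intro z hz
    refine (ae_restrict_iff' measurableSet_ball).2 (Eventually.of_forall fun y hy => ?_)
    rw [norm_mul, Real.norm_eq_abs (f y)]
    refine mul_le_mul_of_nonneg_right (hC _ ?_) (abs_nonneg _)
    have h1 : ‖z‖ ≤ S := by simpa using hz
    have h2 : ‖y‖ < R := by simpa using hy
    simpa using (norm_sub_le z y).trans (by linarith)
  · exact integrableOn_ball_mul hf.abs continuous_const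
  · exact Eventually.of_forall fun y =>
      ((hk.comp (continuous_id.sub continuous_const)).mul continuous_const).continuousOn

theorem logPotential_nonneg {c ε R S : ℝ} {f : ℂ → ℝ} (hε : 0 < ε)
    (hf : ∀ z ∈ closedBall (0 : ℂ) R, 0 ≤ f z) (hSR : S ≤ R) (hεR : ε ≤ R)
    (hc : 5 * R ^ 2 ≤ c) : ∀ z ∈ closedBall (0 : ℂ) S, 0 ≤ logPotential c ε R f z := by
  intro z hz
  refine setIntegral_nonneg measurableSet_ball fun y hy => ?_
  refine mul_nonneg (logKernel_nonneg hε ?_) (hf y (ball_subset_closedBall hy))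
  have h1 : ‖z‖ ≤ S := by simpa using hz
  have h2 : ‖y‖ < R := by simpa using hy
  have h3 : ‖z - y‖ ≤ 2 * R := (norm_sub_le z y).trans (by linarith)
  nlinarith [norm_nonneg (z - y)]

/-- For small regularisation scale, the potential almost solves `ΔΦ = -f`. -/
theorem exists_logPotential_supersolution {c R S d : ℝ} {f : ℂ → ℝ} (hc : 0 < c) (hS : 0 < S)
    (hSR : S < R) (hf : ContinuousOn f (closedBall 0 R))
    (hf0 : ∀ z ∈ closedBall (0 : ℂ) R, 0 ≤ f z) (hd : 0 < d) :
    ∃ ε, 0 < ε ∧ ε ≤ R ∧ ∀ z ∈ ball (0 : ℂ) S, ∀ᶠ s : ℝ in nhdsWithin 0 (Ioi 0),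
      fivePoint (logPotential c ε R f) z s ≤ s ^ 2 * (-f z + d) := by
  have hR : 0 < R := hS.trans hSR
  have hπ := Real.pi_pos
  obtain ⟨C, hC⟩ := (isCompact_closedBall (0 : ℂ) R).exists_bound_of_continuousOn hf
  have hC0 : 0 ≤ C := (norm_nonneg _).trans (hC 0 (by simpa using hR.le))
  obtain ⟨κ₀, hκ₀, hκ₀'⟩ := Metric.uniformContinuousOn_iff.1
    ((isCompact_closedBall (0 : ℂ) R).uniformContinuousOn_of_continuous hf) (d / 4) (by positivity)
  set κ := min κ₀ (R - S) with hκ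
  have hκ0 : 0 < κ := lt_min hκ₀ (sub_pos.2 hSR)
  obtain ⟨ε, hε0, hεR, hεC⟩ : ∃ ε, 0 < ε ∧ ε ≤ R ∧ C * ε ^ 2 ≤ d / 4 * κ ^ 2 := by
    have hcont : Tendsto (fun ε : ℝ => C * ε ^ 2) (nhdsWithin 0 (Ioi 0)) (nhds 0) := by
      have : Continuous fun ε : ℝ => C * ε ^ 2 := by fun_prop
      simpa using (this.tendsto 0).mono_left (nhdsWithin_le_nhds (s := Ioi 0))
    obtain ⟨ε, ⟨h1, h2⟩, h3⟩ := ((hcont.eventually (gt_mem_nhds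
      (show 0 < d / 4 * κ ^ 2 by positivity))).and self_mem_nhdsWithin |>.and
      ((gt_mem_nhds hR).filter_mono nhdsWithin_le_nhds)).exists
    exact ⟨ε, h2, h3.le, h1.le⟩
  refine ⟨ε, hε0, hεR, fun z hz => ?_⟩
  have hzS : ‖z‖ < S := by simpa using hz
  have hzR : z ∈ closedBall (0 : ℂ) R := by simpa using (hzS.trans hSR).le
  have hk := continuous_logKernel hc hε0
  set η : ℂ → ℝ := fun x => ε ^ 2 / (‖x‖ ^ 2 + ε ^ 2) ^ 2 with hη
  have hηc : Continuous η := by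
    refine continuous_const.div (by fun_prop) fun x => ?_
    positivity
  have hηz : Continuous fun y => η (z - y) := hηc.comp (continuous_const.sub continuous_id)
  have hηf := integrableOn_ball_mul hf hηz
  set M := ∫ y in ball (0 : ℂ) R, f y with hM
  have hfint : IntegrableOn f (ball (0 : ℂ) R) := by
    simpa using integrableOn_ball_mul hf (continuous_const (y := (1 : ℝ)))
  -- the mollification is close to `f`
  have hmoll : Real.pi * (f z - d / 2) ≤ ∫ y in ball (0 : ℂ) R, η (z - y) * f y := by
    have hsub : ball z κ ⊆ ball (0 : ℂ) R := by
      refine ball_subset_ball' ?_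
      rw [dist_zero_right]
      have : κ ≤ R - S := min_le_right _ _
      linarith
    have h1 : ∫ y in ball z κ, η (z - y) * f y ≤ ∫ y in ball (0 : ℂ) R, η (z - y) * f y := by
      refine setIntegral_mono_set hηf ?_ hsub.eventuallyLE
      refine (ae_restrict_iff' measurableSet_ball).2 (Eventually.of_forall fun y hy => ?_)
      have := hf0 y (ball_subset_closedBall hy)
      simp only [hη, Pi.zero_apply]
      positivity
    have h2 : ∫ y in ball z κ, η (z - y) * (f z - d / 4) ≤ ∫ y in ball z κ, η (z - y) * f y := by
      refine setIntegral_mono_on ?_ (hηf.mono_set hsub) measurableSet_ball fun y hy => ?_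
      · exact ((hηz.mul continuous_const).continuousOn.integrableOn_compact
          (isCompact_closedBall z κ)).mono_set ball_subset_closedBall
      · have hdist := hκ₀' y (ball_subset_closedBall (hsub hy)) z hzR
          (lt_of_lt_of_le (mem_ball.1 hy) (min_le_left _ _))
        rw [Real.dist_eq] at hdist
        have h3 : 0 ≤ η (z - y) := by simp only [hη]; positivity
        have := (abs_lt.1 hdist).1
        exact mul_le_mul_of_nonneg_left (by linarith) h3
    have h3 : ∫ y in ball z κ, η (z - y) = Real.pi * (κ ^ 2 / (κ ^ 2 + ε ^ 2)) := by
      rw [← integral_ball_mollifier hε0 hκ0.le, ← integral_indicator measurableSet_ball,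
        ← integral_indicator measurableSet_ball, 
        ← integral_sub_left_eq_self ((ball (0 : ℂ) κ).indicator
          fun x => ε ^ 2 / (‖x‖ ^ 2 + ε ^ 2) ^ 2) volume z]
      congr 1
      ext y
      by_cases hy : ‖z - y‖ < κ
      · have hy' : y ∈ ball z κ := by rwa [mem_ball, dist_comm, Complex.dist_eq]
        rw [indicator_of_mem hy', indicator_of_mem]
        simpa using hy
      · have hy' : y ∉ ball z κ := by rwa [mem_ball, dist_comm, Complex.dist_eq]
        rw [indicator_of_notMem hy', indicator_of_notMem]
        simpa using hy
    rw [integral_mul_const, h3] at h2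
    refine le_trans ?_ (h2.trans h1)
    rw [mul_assoc]
    refine mul_le_mul_of_nonneg_left ?_ hπ.le
    have hfz0 := hf0 z hzR
    have hfz : f z ≤ C := (le_abs_self _).trans (hC z hzR)
    rw [div_mul_eq_mul_div, le_div_iff₀ (by positivity)]
    nlinarith [mul_le_mul_of_nonneg_right hfz (sq_nonneg ε), sq_nonneg κ, sq_nonneg ε]
  -- second differences of the potential
  have hfive : ∀ s : ℝ, fivePoint (logPotential c ε R f) z s =
      ∫ y in ball (0 : ℂ) R, fivePoint (logKernel c ε) (z - y) s * f y := fun s => by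
    have hint : ∀ w : ℂ, IntegrableOn (fun y => logKernel c ε (w - y) * f y) (ball (0 : ℂ) R) :=
      fun w => integrableOn_ball_mul hf (hk.comp (continuous_const.sub continuous_id))
    simp only [fivePoint, logPotential]
    have i1 := hint (z + s * 1)
    have i2 := hint (z - s * 1)
    have i3 := hint (z + s * Complex.I)
    have i4 := hint (z - s * Complex.I)
    have i0 := (hint z).const_mul 2
    have e := integral_add ((i1.add i2).sub i0) ((i3.add i4).sub i0)
    rw [integral_sub' (i1.add i2) i0, integral_sub' (i3.add i4) i0, integral_add' i1 i2,
      integral_add' i3 i4, integral_const_mul] at e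
    rw [← e]
    refine integral_congr_ae (Eventually.of_forall fun y => ?_)
    simp only [Pi.add_apply, Pi.sub_apply]
    rw [add_sub_right_comm z _ y, sub_right_comm z _ y, add_sub_right_comm z _ y,
      sub_right_comm z _ y]
    ring
  have hsmall : Tendsto (fun s : ℝ => 2 * s ^ 2 / ε ^ 4 * M) (nhdsWithin 0 (Ioi 0)) (nhds 0) := by
    have : Continuous fun s : ℝ => 2 * s ^ 2 / ε ^ 4 * M := by fun_prop
    simpa using (this.tendsto 0).mono_left (nhdsWithin_le_nhds (s := Ioi 0))
  filter_upwards [self_mem_nhdsWithin, (gt_mem_nhds hε0).filter_mono nhdsWithin_le_nhds,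
    hsmall.eventually (gt_mem_nhds (half_pos hd))] with s hs hsε hsM
  have hs0 : 0 < s := hs
  rw [hfive]
  have h1 : ∫ y in ball (0 : ℂ) R, fivePoint (logKernel c ε) (z - y) s * f y ≤
      ∫ y in ball (0 : ℂ) R,
        (-(s ^ 2 / Real.pi) * (η (z - y) * f y) + 2 * s ^ 4 / ε ^ 4 * f y) := by
    refine setIntegral_mono_on ?_ ((hηf.const_mul _).add (hfint.const_mul _)) measurableSet_ball
      fun y hy => ?_
    · refine integrableOn_ball_mul hf ?_
      unfold fivePoint
      fun_prop
    · have := mul_le_mul_of_nonneg_right (fivePoint_logKernel_le hc hε0 hs0 hsε.le (z - y))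
        (hf0 y (ball_subset_closedBall hy))
      refine this.trans (le_of_eq ?_)
      simp only [hη]
      ring
  rw [integral_add (hηf.const_mul _) (hfint.const_mul _), integral_const_mul,
    integral_const_mul] at h1
  have h2 := mul_le_mul_of_nonneg_left hmoll (show 0 ≤ s ^ 2 / Real.pi by positivity)
  have h3 : s ^ 2 / Real.pi * (Real.pi * (f z - d / 2)) = s ^ 2 * (f z - d / 2) := by
    field_simp
  have h4 : 2 * s ^ 4 / ε ^ 4 * M = s ^ 2 * (2 * s ^ 2 / ε ^ 4 * M) := by ring
  have h5 := mul_le_mul_of_nonneg_left hsM.le (sq_nonneg s)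
  rw [h3] at h2
  rw [← hM, h4] at h1
  linarith

namespace LogDiffusion

/-- A local solution is controlled by the regularised logarithmic potential of its values at an
earlier time. -/
theorem exists_le_exp_logPotential {ρ T : ℝ} {u : ℂ → ℝ → ℝ} (h : LogDiffusion ρ T u)
    {R S a b c : ℝ} (hS : 0 < S) (hSR : S < R) (hR : R < ρ) (ha : 0 < a) (hab : a < b)
    (hb : b < T) (hc : 5 * R ^ 2 ≤ c) :
    ∃ ε, 0 < ε ∧ ε ≤ R ∧ ∀ z ∈ ball (0 : ℂ) S, u z b ≤ 2 * Real.exp 1 * (b - a) * hyp S z *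
      Real.exp (logPotential c ε R (fun w => u w a) z / (b - a)) := by
  have hba : 0 < b - a := sub_pos.2 hab
  have haT : a ∈ Ioo 0 T := ⟨ha, hab.trans hb⟩
  have hR0 : 0 < R := hS.trans hSR
  have hc0 : 0 < c := lt_of_lt_of_le (by positivity) hc
  have hf := (h.continuousOn_slice haT).mono (closedBall_subset_ball hR)
  have hf0 : ∀ z ∈ closedBall (0 : ℂ) R, 0 ≤ u z a := fun z hz =>
    (h.pos (z, a) ⟨closedBall_subset_ball hR hz, haT⟩).le
  obtain ⟨ε, hε0, hεR, hε⟩ := exists_logPotential_supersolution (d := (b - a) * (4 / S ^ 2)) hc0 hS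
    hSR hf hf0 (by positivity)
  refine ⟨ε, hε0, hεR, h.harnack hS (hSR.trans hR) ha hab hb
    (continuousOn_logPotential hc0 hε0 hf S)
    (logPotential_nonneg hε0 hf0 hSR.le hεR hc) ?_ hε⟩
  have : 0 < S ^ 2 := by positivity
  gcongr
  norm_num

end LogDiffusion

/-- The Riesz-type kernel `(c / |x|²) ^ α` regularised at scale `ε`. -/
noncomputable def rieszKernel (c ε α : ℝ) (x : ℂ) : ℝ := (c / (‖x‖ ^ 2 + ε ^ 2)) ^ α

theorem continuous_rieszKernel {c ε : ℝ} (hc : 0 < c) (hε : 0 < ε) (α : ℝ) :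
    Continuous (rieszKernel c ε α) := by
  have : ∀ x : ℂ, ‖x‖ ^ 2 + ε ^ 2 ≠ 0 := fun x => by positivity
  exact Continuous.rpow_const (continuous_const.div (by fun_prop) this)
    fun x => Or.inl (div_ne_zero hc.ne' (this x))

theorem rieszKernel_nonneg {c ε : ℝ} (hc : 0 ≤ c) (α : ℝ) (x : ℂ) : 0 ≤ rieszKernel c ε α x :=
  Real.rpow_nonneg (by positivity) _

theorem rieszKernel_neg (c ε α : ℝ) (x : ℂ) : rieszKernel c ε α (-x) = rieszKernel c ε α x := by
  simp [rieszKernel]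

theorem logKernel_le_rieszKernel {c ε : ℝ} (hc : 0 ≤ c) (x : ℂ) :
    logKernel c ε x ≤ rieszKernel c ε (1 / 8) x := by
  have h0 : 0 ≤ c / (‖x‖ ^ 2 + ε ^ 2) := by positivity
  have h1 := Real.log_le_rpow_div h0 (show (0 : ℝ) < 1 / 8 by norm_num)
  have h2 : 0 ≤ (c / (‖x‖ ^ 2 + ε ^ 2)) ^ (1 / 8 : ℝ) := Real.rpow_nonneg h0 _
  rw [logKernel, rieszKernel, div_le_iff₀ (by positivity)]
  refine h1.trans ?_
  rw [div_le_iff₀ (by norm_num)]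
  nlinarith [Real.pi_gt_three]

theorem rieszKernel_mul_le {c : ℝ} (hc : 0 ≤ c) (ε ε' : ℝ) (x y : ℂ) :
    rieszKernel c ε (1 / 8) x * rieszKernel c ε' (3 / 4) y ≤
      rieszKernel c ε (7 / 8) x + rieszKernel c ε' (7 / 8) y := by
  have key : ∀ a b : ℝ, 0 ≤ a → 0 ≤ b →
      a ^ (1 / 8 : ℝ) * b ^ (3 / 4 : ℝ) ≤ a ^ (7 / 8 : ℝ) + b ^ (7 / 8 : ℝ) := fun a b ha hb => by
    have hsplit : ∀ m : ℝ, 0 ≤ m → m ^ (1 / 8 : ℝ) * m ^ (3 / 4 : ℝ) = m ^ (7 / 8 : ℝ) :=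
      fun m hm => by
        rw [← Real.rpow_add_of_nonneg hm (by norm_num) (by norm_num)]
        norm_num
    have ha' := Real.rpow_nonneg ha (7 / 8 : ℝ)
    have hb' := Real.rpow_nonneg hb (7 / 8 : ℝ)
    rcases le_total a b with hab | hab
    · calc a ^ (1 / 8 : ℝ) * b ^ (3 / 4 : ℝ) ≤ b ^ (1 / 8 : ℝ) * b ^ (3 / 4 : ℝ) := by gcongr
        _ ≤ _ := by rw [hsplit b hb]; linarith
    · calc a ^ (1 / 8 : ℝ) * b ^ (3 / 4 : ℝ) ≤ a ^ (1 / 8 : ℝ) * a ^ (3 / 4 : ℝ) := by gcongr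
        _ ≤ _ := by rw [hsplit a ha]; linarith
  exact key _ _ (by positivity) (by positivity)

theorem integral_ball_rieszKernel_le {c ε κ : ℝ} (hε : 0 < ε) (hκ : 0 ≤ κ)
    (hκc : κ ^ 2 ≤ c) (hc : 0 < c) :
    ∫ x in ball (0 : ℂ) κ, rieszKernel c ε (7 / 8) x ≤ 8 * Real.pi * c := by
  have hrad := integral_ball_radial (fun y => (c / (y ^ 2 + ε ^ 2)) ^ (7 / 8 : ℝ)) hκ
  simp only [rieszKernel]
  rw [hrad]
  have hcont : Continuous fun y : ℝ => y * (c / (y ^ 2 + ε ^ 2)) ^ (7 / 8 : ℝ) := by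
    have : ∀ y : ℝ, y ^ 2 + ε ^ 2 ≠ 0 := fun y => by positivity
    exact continuous_id.mul (Continuous.rpow_const (continuous_const.div (by fun_prop) this)
      fun y => Or.inl (div_ne_zero hc.ne' (this y)))
  have hmono : ∫ y in (0 : ℝ)..κ, y * (c / (y ^ 2 + ε ^ 2)) ^ (7 / 8 : ℝ) ≤
      ∫ y in (0 : ℝ)..κ, c ^ (7 / 8 : ℝ) * y ^ (-3 / 4 : ℝ) := by
    refine intervalIntegral.integral_mono_on hκ (hcont.intervalIntegrable _ _)
      ((intervalIntegral.intervalIntegrable_rpow' (by norm_num)).const_mul _) fun y hy => ?_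
    rcases hy.1.eq_or_lt with rfl | hy0
    · rw [zero_mul]
      positivity
    · have h1 : (c / (y ^ 2 + ε ^ 2)) ^ (7 / 8 : ℝ) ≤ (c / y ^ 2) ^ (7 / 8 : ℝ) := by
        gcongr
        exact le_add_of_nonneg_right (sq_nonneg ε)
      have h2 : y * (c / y ^ 2) ^ (7 / 8 : ℝ) = c ^ (7 / 8 : ℝ) * y ^ (-3 / 4 : ℝ) := by
        rw [Real.div_rpow hc.le (by positivity), ← Real.rpow_natCast y 2, ← Real.rpow_mul hy0.le,
          div_eq_mul_inv, ← Real.rpow_neg hy0.le, mul_left_comm]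
        congr 1
        rw [← Real.rpow_one_add' hy0.le (by norm_num)]
        norm_num
      exact (mul_le_mul_of_nonneg_left h1 hy0.le).trans h2.le
  rw [intervalIntegral.integral_const_mul, integral_rpow (Or.inl (by norm_num))] at hmono
  have h3 : κ ^ (-3 / 4 + 1 : ℝ) ≤ c ^ (1 / 8 : ℝ) := by
    calc κ ^ (-3 / 4 + 1 : ℝ) = (κ ^ 2) ^ (1 / 8 : ℝ) := by
          rw [← Real.rpow_natCast κ 2, ← Real.rpow_mul hκ]
          norm_num
      _ ≤ c ^ (1 / 8 : ℝ) := by gcongr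
  have h4 : c ^ (7 / 8 : ℝ) * c ^ (1 / 8 : ℝ) = c := by
    rw [← Real.rpow_add hc]
    norm_num
  have h5 : c ^ (7 / 8 : ℝ) * ((κ ^ (-3 / 4 + 1 : ℝ) - 0 ^ (-3 / 4 + 1 : ℝ)) / (-3 / 4 + 1)) ≤
      4 * c := by
    rw [Real.zero_rpow (by norm_num), sub_zero]
    have := mul_le_mul_of_nonneg_left h3 (Real.rpow_nonneg hc.le (7 / 8))
    rw [h4] at this
    calc c ^ (7 / 8 : ℝ) * (κ ^ (-3 / 4 + 1 : ℝ) / (-3 / 4 + 1)) =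
        4 * (c ^ (7 / 8 : ℝ) * κ ^ (-3 / 4 + 1 : ℝ)) := by ring
      _ ≤ 4 * c := by linarith
  have := mul_le_mul_of_nonneg_left (hmono.trans h5) (show 0 ≤ 2 * Real.pi by positivity)
  linarith

theorem integral_ball_rieszKernel_sub_le {c ε κ R : ℝ} {v : ℂ} (hε : 0 < ε) (hκ : 0 ≤ κ)
    (hv : ‖v‖ + R ≤ κ) (hκc : κ ^ 2 ≤ c) (hc : 0 < c) :
    ∫ w in ball (0 : ℂ) R, rieszKernel c ε (7 / 8) (v - w) ≤ 8 * Real.pi * c := by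
  have hk := continuous_rieszKernel hc hε (7 / 8)
  have hkv : Continuous fun w => rieszKernel c ε (7 / 8) (v - w) :=
    hk.comp (continuous_const.sub continuous_id)
  have hsub : ball (0 : ℂ) R ⊆ ball v κ := by
    refine ball_subset_ball' ?_
    rw [dist_zero_left]
    linarith
  have h1 : ∫ w in ball (0 : ℂ) R, rieszKernel c ε (7 / 8) (v - w) ≤
      ∫ w in ball v κ, rieszKernel c ε (7 / 8) (v - w) :=
    setIntegral_mono_set ((hkv.continuousOn.integrableOn_compact
      (isCompact_closedBall v κ)).mono_set ball_subset_closedBall)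
      (Eventually.of_forall fun w => rieszKernel_nonneg hc.le _ _) hsub.eventuallyLE
  refine h1.trans (le_trans (le_of_eq ?_) (integral_ball_rieszKernel_le hε hκ hκc hc))
  rw [← integral_indicator measurableSet_ball, ← integral_indicator measurableSet_ball,
    ← integral_sub_left_eq_self ((ball (0 : ℂ) κ).indicator (rieszKernel c ε (7 / 8))) volume v]
  congr 1
  ext w
  by_cases hw : ‖v - w‖ < κ
  · have hw' : w ∈ ball v κ := by rwa [mem_ball, dist_comm, Complex.dist_eq]
    rw [indicator_of_mem hw', indicator_of_mem]
    simpa using hw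
  · have hw' : w ∉ ball v κ := by rwa [mem_ball, dist_comm, Complex.dist_eq]
    rw [indicator_of_notMem hw', indicator_of_notMem]
    simpa using hw

/-- Jensen's inequality for the exponential of a logarithmic potential. -/
theorem exp_logPotential_mul_le {c ε R τ θ : ℝ} {f : ℂ → ℝ} (hc : 0 < c) (hε : 0 < ε)
    (hτ : 0 < τ) (hf : ContinuousOn f (closedBall 0 R)) (hf0 : ∀ y ∈ ball (0 : ℂ) R, 0 ≤ f y)
    (hM : 0 < ∫ y in ball (0 : ℂ) R, f y)
    (hθ : ∫ y in ball (0 : ℂ) R, f y ≤ 4 * Real.pi * τ * θ) {z : ℂ}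
    (hz : ∀ y ∈ ball (0 : ℂ) R, ‖z - y‖ ^ 2 + ε ^ 2 ≤ c) :
    Real.exp (logPotential c ε R f z / τ) * ∫ y in ball (0 : ℂ) R, f y ≤
      ∫ y in ball (0 : ℂ) R, rieszKernel c ε θ (z - y) * f y := by
  have hπ := Real.pi_pos
  set M := ∫ y in ball (0 : ℂ) R, f y with hMdef
  set m := logPotential c ε R f z / τ with hm
  have hsub : Continuous fun y : ℂ => z - y := continuous_const.sub continuous_id
  have hfint : IntegrableOn f (ball (0 : ℂ) R) := by
    simpa using integrableOn_ball_mul hf (continuous_const (y := (1 : ℝ)))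
  have hlint : IntegrableOn (fun y => logKernel c ε (z - y) * f y) (ball (0 : ℂ) R) :=
    integrableOn_ball_mul hf ((continuous_logKernel hc hε).comp hsub)
  have e1 : ∫ y in ball (0 : ℂ) R, (Real.exp m * (1 - m) * f y +
      Real.exp m * (M / τ) * (logKernel c ε (z - y) * f y)) = Real.exp m * M := by
    rw [integral_add (hfint.const_mul _) (hlint.const_mul _), integral_const_mul,
      integral_const_mul]
    have : ∫ y in ball (0 : ℂ) R, logKernel c ε (z - y) * f y = m * τ := by
      rw [hm, div_mul_cancel₀ _ hτ.ne', logPotential]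
    rw [this, ← hMdef]
    field_simp
    ring
  rw [← e1]
  refine setIntegral_mono_on ((hfint.const_mul _).add (hlint.const_mul _))
    (integrableOn_ball_mul hf ((continuous_rieszKernel hc hε θ).comp hsub)) measurableSet_ball
    fun y hy => ?_
  have hbase : 1 ≤ c / (‖z - y‖ ^ 2 + ε ^ 2) := by
    rw [one_le_div (by positivity)]
    exact hz y hy
  have h2 : Real.exp m * (1 - m) + Real.exp m * (M / τ) * logKernel c ε (z - y) ≤
      rieszKernel c ε θ (z - y) := by
    have h3 := Real.add_one_le_exp (M / τ * logKernel c ε (z - y) - m)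
    have h4 : Real.exp (M / τ * logKernel c ε (z - y)) ≤ rieszKernel c ε θ (z - y) := by
      rw [rieszKernel, Real.rpow_def_of_pos (lt_of_lt_of_le one_pos hbase), logKernel]
      refine Real.exp_le_exp.2 ?_
      have hl := Real.log_nonneg hbase
      have : M / τ * (Real.log (c / (‖z - y‖ ^ 2 + ε ^ 2)) / (4 * Real.pi)) =
          Real.log (c / (‖z - y‖ ^ 2 + ε ^ 2)) * (M / (4 * Real.pi * τ)) := by
        field_simp
      rw [this]
      refine mul_le_mul_of_nonneg_left ?_ hl
      rw [div_le_iff₀ (by positivity)]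
      linarith
    refine le_trans ?_ h4
    have h5 : Real.exp (M / τ * logKernel c ε (z - y)) =
        Real.exp m * Real.exp (M / τ * logKernel c ε (z - y) - m) := by
      rw [← Real.exp_add]
      ring_nf
    rw [h5]
    refine le_trans (le_of_eq ?_) (mul_le_mul_of_nonneg_left h3 (Real.exp_pos m).le)
    ring
  have := mul_le_mul_of_nonneg_right h2 (hf0 y hy)
  linarith

theorem integral_ball_mul_integral_le {R R' L : ℝ} {f k' : ℂ → ℝ} {k : ℂ → ℂ → ℝ}
    (hf : ContinuousOn f (closedBall 0 R)) (hf0 : ∀ y ∈ ball (0 : ℂ) R, 0 ≤ f y)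
    (hk' : Continuous k') (hk : Continuous fun p : ℂ × ℂ => k p.1 p.2)
    (hL : ∀ y ∈ ball (0 : ℂ) R, ∫ w in ball (0 : ℂ) R', k' w * k w y ≤ L) :
    IntegrableOn (fun w => k' w * ∫ y in ball (0 : ℂ) R, k w y * f y) (ball 0 R') ∧
    ∫ w in ball (0 : ℂ) R', k' w * ∫ y in ball (0 : ℂ) R, k w y * f y ≤
      L * ∫ y in ball (0 : ℂ) R, f y := by
  have hint : Integrable (Function.uncurry fun w y => k' w * (k w y * f y))
      ((volume.restrict (ball (0 : ℂ) R')).prod (volume.restrict (ball (0 : ℂ) R))) := by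
    rw [Measure.prod_restrict]
    refine IntegrableOn.mono_set (ContinuousOn.integrableOn_compact
      ((isCompact_closedBall 0 R').prod (isCompact_closedBall 0 R)) ?_)
      (prod_mono ball_subset_closedBall ball_subset_closedBall)
    exact (hk'.comp continuous_fst).continuousOn.mul
      (hk.continuousOn.mul (hf.comp continuous_snd.continuousOn fun p hp => hp.2))
  have hfint : IntegrableOn f (ball (0 : ℂ) R) := by
    simpa using integrableOn_ball_mul hf (continuous_const (y := (1 : ℝ)))
  refine ⟨?_, ?_⟩
  · rw [IntegrableOn]
    have := hint.integral_prod_left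
    simpa only [Function.uncurry_apply_pair, integral_const_mul] using this
  · have hswap := integral_integral_swap hint
    simp only [integral_const_mul] at hswap
    rw [hswap, ← integral_const_mul]
    refine setIntegral_mono_on hint.integral_prod_right (hfint.const_mul _) measurableSet_ball
      fun y hy => ?_
    simp only [← mul_assoc, integral_mul_const]
    exact mul_le_mul_of_nonneg_right (hL y hy) (hf0 y hy)

theorem hyp_le_of_norm_lt {R r : ℝ} {z : ℂ} (hr : 0 < r) (hz : ‖z‖ < R)
    (h : 8 * R ^ 2 * r ^ 2 ≤ 40 * (R ^ 2 - ‖z‖ ^ 2) ^ 2) : hyp R z ≤ 40 / r ^ 2 := by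
  have := sq_sub_norm_sq_pos (R := R) (z := z) (by simpa using hz)
  rwa [hyp, div_le_div_iff₀ (by positivity) (by positivity)]

namespace LogDiffusion

/-- The smoothing estimate between two positive times. -/
theorem le_of_integral_lt {r T a b : ℝ} {u : ℂ → ℝ → ℝ} (hr : 0 < r)
    (h : LogDiffusion (3 * r) T u) (ha : 0 < a) (hab : a < b) (hb : b < T)
    (hM : ∫ y in ball (0 : ℂ) (2 * r), u y a < 2 * Real.pi * (b - a)) :
    ∀ z ∈ ball (0 : ℂ) r,
      u z b ≤ 80 * Real.exp 1 * Real.exp (51200 * Real.exp 1 * Real.pi) * r⁻¹ ^ 2 * (b - a) := by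
  have hπ := Real.pi_pos
  have hS : 0 < b - a := sub_pos.2 hab
  have hc : (0 : ℝ) < 20 * r ^ 2 := by positivity
  obtain ⟨t, ht⟩ : ∃ t, t = a + 2 / 3 * (b - a) := ⟨_, rfl⟩
  have hat : a < t := by linarith
  have htb : t < b := by linarith
  have hta : t - a = 2 / 3 * (b - a) := by rw [ht]; ring
  have hbt : b - t = (b - a) / 3 := by rw [ht]; ring
  have haT : a ∈ Ioo 0 T := ⟨ha, hab.trans hb⟩
  have htT : t ∈ Ioo 0 T := ⟨ha.trans hat, htb.trans hb⟩
  obtain ⟨ε₁, hε₁, hε₁r, H₁⟩ := h.exists_le_exp_logPotential (R := 2 * r) (S := 7 / 4 * r)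
    (c := 20 * r ^ 2) (by positivity) (by linarith) (by linarith) ha hat (htb.trans hb)
    (by nlinarith)
  obtain ⟨ε₂, hε₂, hε₂r, H₂⟩ := h.exists_le_exp_logPotential (R := 3 / 2 * r) (S := 5 / 4 * r)
    (c := 20 * r ^ 2) (by positivity) (by linarith) (by linarith) (ha.trans hat) htb hb
    (by nlinarith)
  set f : ℂ → ℝ := fun y => u y a with hf
  have hfc : ContinuousOn f (closedBall 0 (2 * r)) :=
    (h.continuousOn_slice haT).mono (closedBall_subset_ball (by linarith))
  have hgc : ContinuousOn (fun w => u w t) (closedBall 0 (3 / 2 * r)) :=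
    (h.continuousOn_slice htT).mono (closedBall_subset_ball (by linarith))
  have hfpos : ∀ y ∈ ball (0 : ℂ) (2 * r), 0 < f y := fun y hy =>
    h.pos (y, a) ⟨ball_subset_ball (by linarith) hy, haT⟩
  have hfint : IntegrableOn f (ball (0 : ℂ) (2 * r)) :=
    (hfc.integrableOn_compact (isCompact_closedBall _ _)).mono_set ball_subset_closedBall
  set M := ∫ y in ball (0 : ℂ) (2 * r), f y with hMdef
  have hMpos : 0 < M := by
    refine (setIntegral_pos_iff_support_of_nonneg_ae ((ae_restrict_iff' measurableSet_ball).2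
      (Eventually.of_forall fun y hy => (hfpos y hy).le)) hfint).2 ?_
    have : Function.support f ∩ ball (0 : ℂ) (2 * r) = ball 0 (2 * r) :=
      inter_eq_right.2 fun y hy => (hfpos y hy).ne'
    rw [this]
    exact measure_ball_pos _ _ (by positivity)
  set B := 2 * Real.exp 1 * (t - a) * (40 / r ^ 2) with hB
  have hB0 : 0 ≤ B := by
    have := (sub_pos.2 hat).le
    positivity
  -- the solution at the intermediate time is bounded by a Riesz potential
  have hmid : ∀ w ∈ ball (0 : ℂ) (3 / 2 * r), u w t * M ≤
      B * ∫ y in ball (0 : ℂ) (2 * r), rieszKernel (20 * r ^ 2) ε₁ (3 / 4) (w - y) * f y := by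
    intro w hw
    have hw' : ‖w‖ < 3 / 2 * r := by simpa using hw
    have hhyp : hyp (7 / 4 * r) w ≤ 40 / r ^ 2 := by
      refine hyp_le_of_norm_lt hr (by linarith) ?_
      have h1 : ‖w‖ ^ 2 ≤ (3 / 2 * r) ^ 2 := by gcongr
      have h2 : 13 / 16 * r ^ 2 ≤ (7 / 4 * r) ^ 2 - ‖w‖ ^ 2 := by nlinarith
      have h3 : (13 / 16 * r ^ 2) ^ 2 ≤ ((7 / 4 * r) ^ 2 - ‖w‖ ^ 2) ^ 2 := by gcongr
      nlinarith [sq_nonneg (r ^ 2)]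
    have h1 := H₁ w (ball_subset_ball (by linarith) hw)
    have hJ := exp_logPotential_mul_le (θ := 3 / 4) (τ := t - a) (z := w) hc hε₁ (sub_pos.2 hat)
      hfc (fun y hy => (hfpos y hy).le) hMpos (by rw [hta]; linarith) fun y hy => by
        have hy' : ‖y‖ < 2 * r := by simpa using hy
        have : ‖w - y‖ ≤ 7 / 2 * r := (norm_sub_le w y).trans (by linarith)
        have : ‖w - y‖ ^ 2 ≤ (7 / 2 * r) ^ 2 := by gcongr
        have : ε₁ ^ 2 ≤ (2 * r) ^ 2 := by gcongr
        nlinarith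
    have h2 : u w t ≤ B * Real.exp (logPotential (20 * r ^ 2) ε₁ (2 * r) f w / (t - a)) := by
      have := (sub_pos.2 hat).le
      refine h1.trans ?_
      rw [hB]
      gcongr
    calc u w t * M ≤
        B * Real.exp (logPotential (20 * r ^ 2) ε₁ (2 * r) f w / (t - a)) * M := by gcongr
      _ = B * (Real.exp (logPotential (20 * r ^ 2) ε₁ (2 * r) f w / (t - a)) * M) := by ring
      _ ≤ _ := by gcongr
  intro z hz
  have hz' : ‖z‖ < r := by simpa using hz
  have hsub : Continuous fun w : ℂ => z - w := continuous_const.sub continuous_id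
  have hk₂ := (continuous_rieszKernel hc hε₂ (1 / 8)).comp hsub
  have hk₁ : Continuous fun p : ℂ × ℂ => rieszKernel (20 * r ^ 2) ε₁ (3 / 4) (p.1 - p.2) :=
    (continuous_rieszKernel hc hε₁ (3 / 4)).comp (continuous_fst.sub continuous_snd)
  have hL : ∀ y ∈ ball (0 : ℂ) (2 * r), ∫ w in ball (0 : ℂ) (3 / 2 * r),
      rieszKernel (20 * r ^ 2) ε₂ (1 / 8) (z - w) * rieszKernel (20 * r ^ 2) ε₁ (3 / 4) (w - y) ≤
        320 * Real.pi * r ^ 2 := by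
    intro y hy
    have hy' : ‖y‖ < 2 * r := by simpa using hy
    have i₂ : ∀ (ε α : ℝ) (v : ℂ), 0 < ε → IntegrableOn
        (fun w => rieszKernel (20 * r ^ 2) ε α (v - w)) (ball (0 : ℂ) (3 / 2 * r)) :=
      fun ε α v hε => (((continuous_rieszKernel hc hε α).comp
        (continuous_const.sub continuous_id)).continuousOn.integrableOn_compact
        (isCompact_closedBall _ _)).mono_set ball_subset_closedBall
    have b₁ := integral_ball_rieszKernel_sub_le (κ := 7 / 2 * r) (R := 3 / 2 * r) (v := z) hε₂
      (by positivity) (by linarith) (by nlinarith) hc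
    have b₂ := integral_ball_rieszKernel_sub_le (κ := 7 / 2 * r) (R := 3 / 2 * r) (v := y) hε₁
      (by positivity) (by linarith) (by nlinarith) hc
    calc ∫ w in ball (0 : ℂ) (3 / 2 * r), rieszKernel (20 * r ^ 2) ε₂ (1 / 8) (z - w) *
          rieszKernel (20 * r ^ 2) ε₁ (3 / 4) (w - y) ≤
        ∫ w in ball (0 : ℂ) (3 / 2 * r), (rieszKernel (20 * r ^ 2) ε₂ (7 / 8) (z - w) +
          rieszKernel (20 * r ^ 2) ε₁ (7 / 8) (y - w)) := by
          refine setIntegral_mono_on ?_ ((i₂ _ _ _ hε₂).add (i₂ _ _ _ hε₁)) measurableSet_ball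
            fun w _ => ?_
          · exact ((hk₂.mul ((continuous_rieszKernel hc hε₁ (3 / 4)).comp
              (continuous_id.sub continuous_const))).continuousOn.integrableOn_compact
              (isCompact_closedBall _ _)).mono_set ball_subset_closedBall
          · rw [← rieszKernel_neg _ _ _ (y - w), neg_sub]
            exact rieszKernel_mul_le hc.le _ _ _ _
      _ ≤ 8 * Real.pi * (20 * r ^ 2) + 8 * Real.pi * (20 * r ^ 2) := by
          rw [integral_add (i₂ _ _ _ hε₂) (i₂ _ _ _ hε₁)]
          exact add_le_add b₁ b₂
      _ = 320 * Real.pi * r ^ 2 := by ring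
  obtain ⟨hint, hle⟩ := integral_ball_mul_integral_le (R' := 3 / 2 * r) hfc
    (fun y hy => (hfpos y hy).le) hk₂ hk₁ hL
  have hpot : logPotential (20 * r ^ 2) ε₂ (3 / 2 * r) (fun w => u w t) z * M ≤
      B * (320 * Real.pi * r ^ 2 * M) := by
    refine le_trans ?_ (mul_le_mul_of_nonneg_left hle hB0)
    rw [logPotential, ← integral_mul_const, ← integral_const_mul]
    refine setIntegral_mono_on ((integrableOn_ball_mul hgc
      ((continuous_logKernel hc hε₂).comp hsub)).mul_const M) (hint.const_mul B) measurableSet_ball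
      fun w hw => ?_
    have hu := h.pos (w, t) ⟨ball_subset_ball (by linarith) hw, htT⟩
    have h1 := logKernel_le_rieszKernel (ε := ε₂) hc.le (z - w)
    have h2 := rieszKernel_nonneg (ε := ε₂) hc.le (1 / 8) (z - w)
    calc logKernel (20 * r ^ 2) ε₂ (z - w) * u w t * M ≤
        rieszKernel (20 * r ^ 2) ε₂ (1 / 8) (z - w) * u w t * M := by gcongr
      _ = rieszKernel (20 * r ^ 2) ε₂ (1 / 8) (z - w) * (u w t * M) := by ring
      _ ≤ rieszKernel (20 * r ^ 2) ε₂ (1 / 8) (z - w) * (B * _) :=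
          mul_le_mul_of_nonneg_left (hmid w hw) h2
      _ = _ := by simp only [Function.comp_def]; ring
  have hexp : logPotential (20 * r ^ 2) ε₂ (3 / 2 * r) (fun w => u w t) z / (b - t) ≤
      51200 * Real.exp 1 * Real.pi := by
    rw [div_le_iff₀ (sub_pos.2 htb)]
    refine le_of_mul_le_mul_right (hpot.trans (le_of_eq ?_)) hMpos
    rw [hB, hta, hbt]
    field_simp
    ring
  have hhyp : hyp (5 / 4 * r) z ≤ 40 / r ^ 2 := by
    refine hyp_le_of_norm_lt hr (by linarith) ?_
    have h1 : ‖z‖ ^ 2 ≤ r ^ 2 := by gcongr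
    have h2 : 9 / 16 * r ^ 2 ≤ (5 / 4 * r) ^ 2 - ‖z‖ ^ 2 := by nlinarith
    have h3 : (9 / 16 * r ^ 2) ^ 2 ≤ ((5 / 4 * r) ^ 2 - ‖z‖ ^ 2) ^ 2 := by gcongr
    nlinarith [sq_nonneg (r ^ 2)]
  have hbt0 := (sub_pos.2 htb).le
  calc u z b ≤ 2 * Real.exp 1 * (b - t) * hyp (5 / 4 * r) z *
        Real.exp (logPotential (20 * r ^ 2) ε₂ (3 / 2 * r) (fun w => u w t) z / (b - t)) :=
        H₂ z (ball_subset_ball (by linarith) hz)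
    _ ≤ 2 * Real.exp 1 * (b - t) * (40 / r ^ 2) *
        Real.exp (51200 * Real.exp 1 * Real.pi) := by gcongr
    _ = 1 / 3 * (80 * Real.exp 1 * Real.exp (51200 * Real.exp 1 * Real.pi) * r⁻¹ ^ 2 *
        (b - a)) := by
        rw [hbt]
        field_simp
        ring
    _ ≤ _ := by
        have : 0 ≤ 80 * Real.exp 1 * Real.exp (51200 * Real.exp 1 * Real.pi) * r⁻¹ ^ 2 *
          (b - a) := by positivity
        linarith

end LogDiffusion

/-- A measure giving a compact set little mass is tested below by a cutoff of that set. -/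
theorem exists_cutoff_integral_lt {μ : Measure ℂ} [IsFiniteMeasureOnCompacts μ] {K V : Set ℂ}
    {m : ℝ} (hK : IsCompact K) (hV : IsOpen V) (hKV : K ⊆ V) (hm : (μ K).toReal < m) :
    ∃ f : ℂ → ℝ, Continuous f ∧ HasCompactSupport f ∧ tsupport f ⊆ V ∧ (∀ x, 0 ≤ f x) ∧
      (∀ x ∈ K, f x = 1) ∧ ∫ x, f x ∂μ < m := by
  have hm0 : 0 < m := ENNReal.toReal_nonneg.trans_lt hm
  have hKm : μ K < ENNReal.ofReal m :=
    (ENNReal.lt_ofReal_iff_toReal_lt hK.measure_lt_top.ne).2 hm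
  obtain ⟨U, hKU, hU, hUm⟩ := K.exists_isOpen_lt_of_lt _ hKm
  obtain ⟨f, hf1, hfc, hfs, hf01⟩ := exists_continuousMap_one_of_isCompact_subset_isOpen hK
    (hU.inter hV) (subset_inter hKU hKV)
  refine ⟨f, f.continuous, hfc, hfs.trans inter_subset_right, fun x => (hf01 x).1, hf1, ?_⟩
  have hle : ∀ x, f x ≤ U.indicator (fun _ => (1 : ℝ)) x := fun x => by
    by_cases hx : x ∈ U
    · simpa [hx] using (hf01 x).2
    · have : x ∉ tsupport f := fun h => hx (hfs h).1
      simp [hx, image_eq_zero_of_notMem_tsupport this]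
  have hint : Integrable (U.indicator fun _ => (1 : ℝ)) μ :=
    (integrable_indicator_iff hU.measurableSet).2
      (integrableOn_const (hUm.trans ENNReal.ofReal_lt_top).ne)
  calc ∫ x, f x ∂μ ≤ ∫ x, U.indicator (fun _ => (1 : ℝ)) x ∂μ :=
        integral_mono (f.continuous.integrable_of_hasCompactSupport hfc) hint hle
    _ = (μ U).toReal := by
        rw [integral_indicator hU.measurableSet]
        simp [Measure.real]
    _ < m := (ENNReal.lt_ofReal_iff_toReal_lt (hUm.trans ENNReal.ofReal_lt_top).ne).1 hUm

theorem LogDiffusion.integral_ball_le_integral_mul {ρ R T t : ℝ} {u : ℂ → ℝ → ℝ} {f : ℂ → ℝ}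
    (h : LogDiffusion ρ T u) (ht : t ∈ Ioo 0 T) (hf : Continuous f)
    (hfc : HasCompactSupport f) (hfs : tsupport f ⊆ ball 0 ρ) (hf0 : ∀ x, 0 ≤ f x)
    (hf1 : ∀ x ∈ closedBall (0 : ℂ) R, f x = 1) :
    ∫ z in ball (0 : ℂ) R, u z t ≤ ∫ z, f z * u z t := by
  have hsupp : Function.support (fun z => f z * u z t) ⊆ tsupport f := fun z hz =>
    subset_tsupport f (left_ne_zero_of_mul hz)
  have hint : Integrable fun z => f z * u z t :=
    (integrableOn_iff_integrable_of_support_subset hsupp).1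
      ((hf.continuousOn.mul ((h.continuousOn_slice ht).mono hfs)).integrableOn_compact hfc)
  have h1 : ∫ z in ball (0 : ℂ) R, u z t = ∫ z in ball (0 : ℂ) R, f z * u z t :=
    setIntegral_congr_fun measurableSet_ball fun z hz => by
      simp only [hf1 z (ball_subset_closedBall hz), one_mul]
  rw [h1]
  refine setIntegral_le_integral hint (Eventually.of_forall fun z => ?_)
  by_cases hz : z ∈ tsupport f
  · exact mul_nonneg (hf0 z) (h.pos (z, t) ⟨hfs hz, ht⟩).le
  · simp [image_eq_zero_of_notMem_tsupport hz]

/-- `L¹–L∞` smoothing for conformal Ricci flows (solutions of the logarithmic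
fast diffusion equation) starting weakly from a non-atomic Radon measure. -/
theorem L1_Linfty_smoothing :
    ∃ C₀ : ℝ, 0 < C₀ ∧
      ∀ (r T : ℝ), 0 < r → 0 < T →
      ∀ u : ℂ → ℝ → ℝ,
        (∀ p ∈ (Metric.ball (0:ℂ) (3*r)) ×ˢ Ioo (0:ℝ) T, 0 < u p.1 p.2) →
        ContDiffOn ℝ (⊤ : ℕ∞) (fun p : ℂ × ℝ => u p.1 p.2)
          ((Metric.ball (0:ℂ) (3*r)) ×ˢ Ioo (0:ℝ) T) →
        (∀ p ∈ (Metric.ball (0:ℂ) (3*r)) ×ˢ Ioo (0:ℝ) T,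
          deriv (u p.1) p.2 = lap (fun z => Real.log (u z p.2)) p.1) →
      ∀ μ : Measure ℂ,
        μ ≠ 0 → (∀ z : ℂ, μ {z} = 0) →
        (∀ K : Set ℂ, IsCompact K → μ K < ⊤) →
        μ (Metric.ball (0:ℂ) (3*r))ᶜ = 0 →
        -- the flow starts weakly from `μ`
        (∀ f : ℂ → ℝ, Continuous f → HasCompactSupport f →
          tsupport f ⊆ Metric.ball (0:ℂ) (3*r) →
          Tendsto (fun t => ∫ z, f z * u z t) (nhdsWithin 0 (Ioi 0))
            (nhds (∫ z, f z ∂μ))) →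
      ∀ t ∈ Ioo (0:ℝ) T,
        (μ (closure (Metric.ball (0:ℂ) (2*r)))).toReal / (2 * Real.pi) < t →
        ∀ z ∈ Metric.ball (0:ℂ) r, u z t ≤ C₀ * r⁻¹ ^ 2 * t := by
  refine ⟨80 * Real.exp 1 * Real.exp (51200 * Real.exp 1 * Real.pi), by positivity, ?_⟩
  intro r T hr hT u hpos hsmooth hpde μ _ _ hfin _ hweak t ht hμt z hz
  have h : LogDiffusion (3 * r) T u := ⟨hpos, hsmooth, hpde⟩
  have : IsFiniteMeasureOnCompacts μ := ⟨hfin⟩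
  have hπ := Real.pi_pos
  rw [closure_ball _ (by positivity), div_lt_iff₀ (by positivity)] at hμt
  obtain ⟨f, hf, hfc, hfs, hf0, hf1, hlt⟩ := exists_cutoff_integral_lt
    (isCompact_closedBall (0 : ℂ) (2 * r)) (isOpen_ball (x := (0 : ℂ)) (ε := 3 * r))
    (closedBall_subset_ball (by linarith)) hμt
  have hlim : Tendsto (fun a => t * (2 * Real.pi) - 2 * Real.pi * a) (nhdsWithin 0 (Ioi 0))
      (nhds (t * (2 * Real.pi))) := by
    have : Continuous fun a : ℝ => t * (2 * Real.pi) - 2 * Real.pi * a := by fun_prop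
    simpa using (this.tendsto 0).mono_left (nhdsWithin_le_nhds (s := Ioi 0))
  obtain ⟨a, ⟨ha, ha0⟩, hat⟩ := (((hweak f hf hfc hfs).eventually_lt hlim hlt).and
    self_mem_nhdsWithin |>.and ((gt_mem_nhds ht.1).filter_mono nhdsWithin_le_nhds)).exists
  have hM := h.integral_ball_le_integral_mul ⟨ha0, hat.trans ht.2⟩ hf hfc hfs hf0 hf1
  refine (h.le_of_integral_lt hr ha0 hat ht.2 (by linarith) z hz).trans ?_
  have ha0' : 0 < a := ha0
  gcongr
  linarith
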